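/- arXiv:1309.3117 — 3 statements merged into one kernel-verified Lean document; each statement's English description precedes it below -/
import Mathlib

section
/- Let Ω be an absolute norm on ℝ^d (a norm whose value depends only on the vector of absolute values of the coordinates) and Ω° its dual norm. The following three conditions are equivalent: (a) there exists a non-empty closed convex subset H of ℝ_+^d such that for all x ∈ ℝ^d, Ω(x)² = inf_{η ∈ H} xᵀ Diag(η)⁻¹ x; (b) the function t ↦ Ω(t^{1/2})² is concave on ℝ_+^d (where t^{1/2} denotes the componentwise square root); (c) the function t ↦ Ω°(t^{1/2})² is convex on ℝ_+^d. -/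
open Matrix Set ENNReal NNReal Pointwise

noncomputable section

/-- The dual norm `Ω°(y) = sup {xᵀ y : Ω(x) ≤ 1}`. -/
def dualNorm {d : ℕ} (Om : (Fin d → ℝ) → ℝ) (y : Fin d → ℝ) : ℝ :=
  sSup {t : ℝ | ∃ x, Om x ≤ 1 ∧ t = x ⬝ᵥ y}

structure AbsNorm {d : ℕ} (Om : (Fin d → ℝ) → ℝ) : Prop where
  add : ∀ x y, Om (x + y) ≤ Om x + Om y
  smul : ∀ (c : ℝ) x, Om (c • x) = |c| * Om x
  dfn : ∀ x, Om x = 0 → x = 0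
  abs : ∀ x, Om (fun i => |x i|) = Om x

namespace AbsNorm

variable {d : ℕ} {Om : (Fin d → ℝ) → ℝ}

lemma zero (h : AbsNorm Om) : Om 0 = 0 := by
  have := h.smul 0 0
  simpa using this

lemma nonneg (h : AbsNorm Om) (x : Fin d → ℝ) : 0 ≤ Om x := by
  have h1 := h.add x ((-1 : ℝ) • x)
  rw [h.smul] at h1
  have : x + (-1 : ℝ) • x = 0 := by simp
  rw [this, h.zero] at h1
  simp at h1
  linarith

lemma abs_congr (h : AbsNorm Om) {x y : Fin d → ℝ} (hxy : ∀ i, |x i| = |y i|) : Om x = Om y := by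
  rw [← h.abs x, ← h.abs y]
  congr 1
  funext i
  exact hxy i

lemma convexOn (h : AbsNorm Om) : ConvexOn ℝ univ Om := by
  refine ⟨convex_univ, fun x _ y _ a b ha hb _ => ?_⟩
  have := h.add (a • x) (b • y)
  rw [h.smul, h.smul, abs_of_nonneg ha, abs_of_nonneg hb] at this
  exact this

lemma continuous (h : AbsNorm Om) : Continuous Om :=
  continuousOn_univ.1 (h.convexOn.continuousOn isOpen_univ)

/-- A norming functional. -/
lemma norming0 (h : AbsNorm Om) (x : Fin d → ℝ) :
    ∃ f : Fin d → ℝ, (∀ z, f ⬝ᵥ z ≤ Om z) ∧ f ⬝ᵥ x = Om x := by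
  by_cases hx : x = 0
  · subst hx
    exact ⟨0, fun z => by simpa using h.nonneg z, by simp [h.zero]⟩
  obtain ⟨g, hg1, hg2⟩ := exists_extension_of_le_sublinear
    (LinearPMap.mkSpanSingleton x (Om x) hx : (Fin d → ℝ) →ₗ.[ℝ] ℝ) Om
    (fun c hc x => by rw [h.smul, abs_of_pos hc]) h.add (by
      rintro ⟨z, hz⟩
      obtain ⟨c, rfl⟩ := Submodule.mem_span_singleton.1 hz
      rw [show (LinearPMap.mkSpanSingleton x (Om x) hx) ⟨c • x, hz⟩ = c • Om x from
        LinearPMap.mkSpanSingleton'_apply _ _ _ _ _, h.smul, smul_eq_mul]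
      exact mul_le_mul_of_nonneg_right (le_abs_self c) (h.nonneg x))
  have hgx : g x = Om x := by
    have := hg1 ⟨x, Submodule.mem_span_singleton_self x⟩
    rw [this]
    have h3 := LinearPMap.mkSpanSingleton_apply ℝ ℝ (σ := RingHom.id ℝ) hx (Om x)
    exact h3
  have hrep : ∀ z, (fun i => g (Pi.single i 1)) ⬝ᵥ z = g z := by
    intro z
    conv_rhs => rw [LinearMap.pi_apply_eq_sum_univ g z]
    simp only [dotProduct, smul_eq_mul]
    refine Finset.sum_congr rfl fun i _ => ?_
    rw [mul_comm]
    congr 2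
    funext j
    simp [Pi.single_apply, eq_comm]
  exact ⟨fun i => g (Pi.single i 1), fun z => by rw [hrep]; exact hg2 z, by rw [hrep, hgx]⟩

lemma norming (h : AbsNorm Om) (x : Fin d → ℝ) :
    ∃ f : Fin d → ℝ, (∀ i, 0 ≤ f i) ∧ (∀ z, ∑ i, f i * |z i| ≤ Om z) ∧
      ∑ i, f i * |x i| = Om x := by
  obtain ⟨f, hf1, hf2⟩ := h.norming0 (fun i => |x i|)
  have key : ∀ z, ∑ i, |f i| * |z i| ≤ Om z := by
    intro z
    have h1 := hf1 (fun i => if 0 ≤ f i then |z i| else - |z i|)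
    have h2 : Om (fun i => if 0 ≤ f i then |z i| else - |z i|) = Om z := by
      apply h.abs_congr
      intro i
      split_ifs <;> simp
    rw [h2] at h1
    refine le_trans (le_of_eq ?_) h1
    refine Finset.sum_congr rfl fun i _ => ?_
    dsimp only
    split_ifs with hi
    · rw [abs_of_nonneg hi]
    · rw [abs_of_neg (not_le.1 hi)]; ring
  refine ⟨fun i => |f i|, fun i => abs_nonneg _, key, le_antisymm (key x) ?_⟩
  rw [← h.abs x, ← hf2]
  exact Finset.sum_le_sum fun i _ => mul_le_mul_of_nonneg_right (le_abs_self _) (abs_nonneg _)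

lemma mono (h : AbsNorm Om) {x y : Fin d → ℝ} (hxy : ∀ i, |x i| ≤ |y i|) : Om x ≤ Om y := by
  obtain ⟨f, hf0, hf1, hf2⟩ := h.norming x
  rw [← hf2]
  exact le_trans (Finset.sum_le_sum fun i _ => mul_le_mul_of_nonneg_left (hxy i) (hf0 i)) (hf1 y)

lemma single_pos (h : AbsNorm Om) (i : Fin d) : 0 < Om (Pi.single i 1) := by
  refine lt_of_le_of_ne (h.nonneg _) fun h0 => ?_
  have := congrFun (h.dfn _ h0.symm) i
  simp at this

lemma coord_le (h : AbsNorm Om) (x : Fin d → ℝ) (i : Fin d) :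
    |x i| ≤ Om x / Om (Pi.single i 1) := by
  rw [le_div_iff₀ (h.single_pos i), ← h.smul]
  apply h.mono
  intro j
  by_cases hj : j = i
  · subst hj; simp
  · simp [hj]

lemma bdd (h : AbsNorm Om) (y : Fin d → ℝ) : BddAbove {t : ℝ | ∃ x, Om x ≤ 1 ∧ t = x ⬝ᵥ y} := by
  refine ⟨∑ i, 1 / Om (Pi.single i 1) * |y i|, ?_⟩
  rintro t ⟨x, hx, rfl⟩
  refine Finset.sum_le_sum fun i _ => ?_
  refine (le_abs_self _).trans ?_
  rw [abs_mul]
  refine mul_le_mul_of_nonneg_right ((h.coord_le x i).trans ?_) (abs_nonneg _)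
  exact div_le_div_of_nonneg_right hx (h.single_pos i).le

lemma le_dual (h : AbsNorm Om) (y : Fin d → ℝ) {x : Fin d → ℝ} (hx : Om x ≤ 1) :
    x ⬝ᵥ y ≤ dualNorm Om y :=
  le_csSup (h.bdd y) ⟨x, hx, rfl⟩

lemma dual_le (h : AbsNorm Om) (y : Fin d → ℝ) {c : ℝ} (hc : ∀ x, Om x ≤ 1 → x ⬝ᵥ y ≤ c) :
    dualNorm Om y ≤ c := by
  refine csSup_le ⟨0, 0, by simp [h.zero], by simp⟩ ?_
  rintro t ⟨x, hx, rfl⟩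
  exact hc x hx

lemma dual_nonneg (h : AbsNorm Om) (y : Fin d → ℝ) : 0 ≤ dualNorm Om y := by
  have := h.le_dual y (x := 0) (by simp [h.zero])
  simpa using this

lemma dot_le (h : AbsNorm Om) (x y : Fin d → ℝ) : x ⬝ᵥ y ≤ Om x * dualNorm Om y := by
  by_cases h0 : Om x = 0
  · rw [h.dfn x h0]; simp [h.zero]
  have hp : 0 < Om x := lt_of_le_of_ne (h.nonneg x) (Ne.symm h0)
  have := h.le_dual y (x := (Om x)⁻¹ • x) (by
    rw [h.smul, abs_of_pos (inv_pos.2 hp), inv_mul_cancel₀ h0])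
  rw [smul_dotProduct, smul_eq_mul, inv_mul_le_iff₀ hp] at this
  exact this

/-- Supergradients (approximate). -/
lemma supergrad (h : AbsNorm Om)
    (hF : ConcaveOn ℝ {t : Fin d → ℝ | ∀ i, 0 ≤ t i} (fun t => (Om fun i => Real.sqrt (t i)) ^ 2))
    (x : Fin d → ℝ) {ε : ℝ} (hε : 0 < ε) :
    ∃ l : Fin d → ℝ, (∀ i, 0 < l i) ∧ (∀ z, Om z ^ 2 ≤ ∑ i, l i * z i ^ 2) ∧
      ∑ i, l i * x i ^ 2 ≤ Om x ^ 2 + ε := by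
  have hcl : IsClosed {t : Fin d → ℝ | ∀ i, 0 ≤ t i} := by
    simp only [ofPred_forall]
    exact isClosed_iInter fun i => isClosed_le continuous_const (continuous_apply i)
  have hcont : Continuous (fun t : Fin d → ℝ => -(Om fun i => Real.sqrt (t i)) ^ 2) := by
    have := h.continuous
    fun_prop
  obtain ⟨L, c, h1, h2⟩ := ConvexOn.exists_affine_le_of_lt (𝕜 := ℝ) (x := fun i => x i ^ 2)
    (a := -(Om fun i => Real.sqrt (x i ^ 2)) ^ 2 - ε)
    (s := {t : Fin d → ℝ | ∀ i, 0 ≤ t i}) (φ := fun t => -(Om fun i => Real.sqrt (t i)) ^ 2)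
    (fun i => sq_nonneg _) (by linarith) hcl
    (hcont.lowerSemicontinuous.lowerSemicontinuousOn _) hF.neg
  have hsq : ∀ z : Fin d → ℝ, (Om fun i => Real.sqrt (z i ^ 2)) = Om z := by
    intro z
    apply h.abs_congr
    intro i
    rw [Real.sqrt_sq_eq_abs, abs_abs]
  have h1' : ∀ z : Fin d → ℝ, L (fun i => z i ^ 2) + c ≤ - Om z ^ 2 := by
    intro z
    have := h1 ⟨fun i => z i ^ 2, fun i => sq_nonneg _⟩
    simpa [hsq] using this
  have h2' : L (fun i => x i ^ 2) + c = - Om x ^ 2 - ε := by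
    rw [hsq] at h2
    simpa using h2
  have hc : c ≤ 0 := by
    have := h1' 0
    have h0 : (fun i : Fin d => (0 : Fin d → ℝ) i ^ 2) = 0 := by funext i; simp
    rw [h0, h.zero] at this
    simpa using this
  have h3 : ∀ z : Fin d → ℝ, Om z ^ 2 ≤ - L (fun i => z i ^ 2) := by
    intro z
    by_contra hcon
    push Not at hcon
    set δ := Om z ^ 2 + L (fun i => z i ^ 2) with hδ
    have hδ0 : 0 < δ := by linarith
    have hsm : ∀ r : ℝ, r ^ 2 * δ ≤ - c := by
      intro r
      have := h1' (r • z)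
      have e : (fun i => (r • z) i ^ 2) = (r ^ 2) • (fun i => z i ^ 2) := by
        funext i; simp [mul_pow]
      rw [e, map_smul, h.smul, mul_pow, sq_abs, smul_eq_mul] at this
      rw [hδ]; nlinarith
    have := hsm (Real.sqrt ((-c + 1) / δ))
    rw [Real.sq_sqrt (by apply div_nonneg <;> linarith), div_mul_cancel₀ _ hδ0.ne'] at this
    linarith
  have hrep : ∀ z : Fin d → ℝ, ∑ i, (- L (Pi.single i 1)) * z i ^ 2 = - L (fun i => z i ^ 2) := by
    intro z
    have := LinearMap.pi_apply_eq_sum_univ (L : (Fin d → ℝ) →ₗ[ℝ] ℝ) (fun i => z i ^ 2)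
    simp only [ContinuousLinearMap.coe_coe] at this
    rw [this, ← Finset.sum_neg_distrib]
    refine Finset.sum_congr rfl fun i _ => ?_
    rw [smul_eq_mul, neg_mul, mul_comm]
    congr 3
    funext j
    simp [Pi.single_apply, eq_comm]
  refine ⟨fun i => - L (Pi.single i 1), fun i => ?_, fun z => ?_, ?_⟩
  · have h4 := h3 (Pi.single i 1)
    have e : (fun j => (Pi.single i 1 : Fin d → ℝ) j ^ 2) = Pi.single i 1 := by
      funext j
      by_cases hj : j = i
      · subst hj; simp
      · simp [hj]
    rw [e] at h4
    exact lt_of_lt_of_le (pow_pos (h.single_pos i) 2) h4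
  · rw [hrep]; exact h3 z
  · rw [hrep]; linarith

lemma orthant_convex : Convex ℝ {t : Fin d → ℝ | ∀ i, 0 ≤ t i} := by
  intro x hx y hy a b ha hb _ i
  exact add_nonneg (mul_nonneg ha (hx i)) (mul_nonneg hb (hy i))

lemma b_to_c (h : AbsNorm Om)
    (hF : ConcaveOn ℝ {t : Fin d → ℝ | ∀ i, 0 ≤ t i}
      (fun t => (Om fun i => Real.sqrt (t i)) ^ 2)) :
    ConvexOn ℝ {t : Fin d → ℝ | ∀ i, 0 ≤ t i}
      (fun t => (dualNorm Om fun i => Real.sqrt (t i)) ^ 2) := by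
  refine ⟨orthant_convex, fun s hs t ht a b ha hb hab => ?_⟩
  have hst := orthant_convex hs ht ha hb hab
  dsimp only [smul_eq_mul]
  set Gs := (dualNorm Om fun i => Real.sqrt (s i)) ^ 2 with hGs
  set Gt := (dualNorm Om fun i => Real.sqrt (t i)) ^ 2 with hGt
  have hD : 0 ≤ a * Gs + b * Gt :=
    add_nonneg (mul_nonneg ha (sq_nonneg _)) (mul_nonneg hb (sq_nonneg _))
  suffices hsuff : dualNorm Om (fun i => Real.sqrt ((a • s + b • t) i)) ≤
      Real.sqrt (a * Gs + b * Gt) by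
    have := pow_le_pow_left₀ (h.dual_nonneg _) hsuff 2
    rwa [Real.sq_sqrt hD] at this
  apply h.dual_le
  intro x hx
  apply Real.le_sqrt_of_sq_le
  have hx2 : Om x ^ 2 ≤ 1 := by
    have := h.nonneg x
    nlinarith
  have main : ∀ ε > 0, (x ⬝ᵥ fun i => Real.sqrt ((a • s + b • t) i)) ^ 2 ≤
      (1 + ε) * (a * Gs + b * Gt) := by
    intro ε hε
    obtain ⟨l, hl0, hl1, hl2⟩ := h.supergrad hF x hε
    have hG : ∀ u : Fin d → ℝ, (∀ i, 0 ≤ u i) →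
        ∑ i, u i / l i ≤ (dualNorm Om fun i => Real.sqrt (u i)) ^ 2 := by
      intro u hu
      set S := ∑ i, u i / l i with hS
      have hS0 : 0 ≤ S := Finset.sum_nonneg fun i _ => div_nonneg (hu i) (hl0 i).le
      have e1 := hl1 (fun i => Real.sqrt (u i) / l i)
      have e1' : ∑ i, l i * (Real.sqrt (u i) / l i) ^ 2 = S := by
        refine Finset.sum_congr rfl fun i _ => ?_
        rw [div_pow, Real.sq_sqrt (hu i)]
        have := (hl0 i).ne'
        field_simp
      have e2 := h.dot_le (fun i => Real.sqrt (u i) / l i) (fun i => Real.sqrt (u i))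
      have e2' : (fun i => Real.sqrt (u i) / l i) ⬝ᵥ (fun i => Real.sqrt (u i)) = S := by
        refine Finset.sum_congr rfl fun i _ => ?_
        dsimp only
        rw [div_mul_eq_mul_div, Real.mul_self_sqrt (hu i)]
      rw [e1'] at e1
      rw [e2'] at e2
      rcases hS0.eq_or_lt with h0 | h0
      · rw [← h0]; positivity
      · have e3 := pow_le_pow_left₀ hS0 e2 2
        rw [mul_pow] at e3
        have e4 := e3.trans (mul_le_mul_of_nonneg_right e1 (sq_nonneg _))
        rw [sq S] at e4
        exact le_of_mul_le_mul_left e4 h0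
    have cs := Finset.sum_mul_sq_le_sq_mul_sq Finset.univ
      (fun i => Real.sqrt (l i) * x i)
      (fun i => Real.sqrt ((a • s + b • t) i) / Real.sqrt (l i))
    have c1 : ∑ i, (Real.sqrt (l i) * x i) * (Real.sqrt ((a • s + b • t) i) / Real.sqrt (l i)) =
        x ⬝ᵥ fun i => Real.sqrt ((a • s + b • t) i) := by
      refine Finset.sum_congr rfl fun i _ => ?_
      have := (Real.sqrt_pos.2 (hl0 i)).ne'
      field_simp
    have c2 : ∑ i, (Real.sqrt (l i) * x i) ^ 2 = ∑ i, l i * x i ^ 2 := by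
      refine Finset.sum_congr rfl fun i _ => ?_
      rw [mul_pow, Real.sq_sqrt (hl0 i).le]
    have c3 : ∑ i, (Real.sqrt ((a • s + b • t) i) / Real.sqrt (l i)) ^ 2 =
        a * ∑ i, s i / l i + b * ∑ i, t i / l i := by
      rw [Finset.mul_sum, Finset.mul_sum, ← Finset.sum_add_distrib]
      refine Finset.sum_congr rfl fun i _ => ?_
      rw [div_pow, Real.sq_sqrt (hl0 i).le, Real.sq_sqrt (hst i)]
      simp only [Pi.add_apply, Pi.smul_apply, smul_eq_mul]
      ring
    rw [c1, c2, c3] at cs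
    refine cs.trans (mul_le_mul (by linarith) ?_ ?_ (by linarith))
    · exact add_le_add (mul_le_mul_of_nonneg_left (hG s hs) ha)
        (mul_le_mul_of_nonneg_left (hG t ht) hb)
    · rw [← c3]; exact Finset.sum_nonneg fun i _ => sq_nonneg _
  set D := a * Gs + b * Gt
  refine le_of_forall_pos_le_add fun ε hε => ?_
  refine (main (ε / (D + 1)) (by positivity)).trans ?_
  have : ε / (D + 1) * D ≤ ε := by
    rw [div_mul_eq_mul_div, div_le_iff₀ (by linarith)]
    nlinarith
  linarith

lemma c_to_b (h : AbsNorm Om)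
    (hG : ConvexOn ℝ {t : Fin d → ℝ | ∀ i, 0 ≤ t i}
      (fun t => (dualNorm Om fun i => Real.sqrt (t i)) ^ 2)) :
    ConcaveOn ℝ {t : Fin d → ℝ | ∀ i, 0 ≤ t i}
      (fun t => (Om fun i => Real.sqrt (t i)) ^ 2) := by
  refine ⟨orthant_convex, fun s hs t ht a b ha hb hab => ?_⟩
  have hst := orthant_convex hs ht ha hb hab
  dsimp only [smul_eq_mul]
  set p := Om fun i => Real.sqrt (s i) with hp
  set q := Om fun i => Real.sqrt (t i) with hq
  set D := a * p ^ 2 + b * q ^ 2 with hDdef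
  have hp0 : 0 ≤ p := h.nonneg _
  have hq0 : 0 ≤ q := h.nonneg _
  have hap : 0 ≤ a * p ^ 2 := by positivity
  have hbq : 0 ≤ b * q ^ 2 := by positivity
  rcases (add_nonneg hap hbq).eq_or_lt with hD | hD
  · rw [← hDdef] at hD
    rw [← hD]; positivity
  rw [← hDdef] at hD
  have get : ∀ u : Fin d → ℝ, ∃ f : Fin d → ℝ, (∀ i, 0 ≤ f i) ∧
      (dualNorm Om fun i => Real.sqrt ((fun i => f i ^ 2) i)) ^ 2 ≤ 1 ∧
      ∑ i, f i * Real.sqrt (u i) = Om fun i => Real.sqrt (u i) := by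
    intro u
    obtain ⟨f, hf0, hf1, hf2⟩ := h.norming (fun i => Real.sqrt (u i))
    refine ⟨f, hf0, ?_, ?_⟩
    · have : dualNorm Om (fun i => Real.sqrt ((fun i => f i ^ 2) i)) ≤ 1 := by
        apply h.dual_le
        intro x hx
        refine le_trans (Finset.sum_le_sum fun i _ => ?_) ((hf1 x).trans hx)
        dsimp only
        rw [Real.sqrt_sq (hf0 i), mul_comm]
        exact mul_le_mul_of_nonneg_left (le_abs_self _) (hf0 i)
      exact pow_le_one₀ (h.dual_nonneg _) this
    · rw [← hf2]
      refine Finset.sum_congr rfl fun i _ => ?_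
      rw [abs_of_nonneg (Real.sqrt_nonneg _)]
  obtain ⟨u, hu0, hu1, hu2⟩ := get s
  obtain ⟨v, hv0, hv1, hv2⟩ := get t
  set α := a * p ^ 2 / D with hα
  set β := b * q ^ 2 / D with hβ
  have hα0 : 0 ≤ α := by positivity
  have hβ0 : 0 ≤ β := by positivity
  have hαβ : α + β = 1 := by
    rw [hα, hβ, ← add_div]; exact div_self hD.ne'
  set w : Fin d → ℝ := α • (fun i => u i ^ 2) + β • (fun i => v i ^ 2) with hw
  have hw1 : dualNorm Om (fun i => Real.sqrt (w i)) ≤ 1 := by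
    have := hG.2 (x := fun i => u i ^ 2) (fun i => sq_nonneg _) (y := fun i => v i ^ 2)
      (fun i => sq_nonneg _) hα0 hβ0 hαβ
    dsimp only [smul_eq_mul] at this
    have h2 : (dualNorm Om fun i => Real.sqrt (w i)) ^ 2 ≤ 1 := by
      refine this.trans ?_
      nlinarith
    exact (sq_le_one_iff₀ (h.dual_nonneg _)).1 h2
  have key := h.dot_le (fun i => Real.sqrt ((a • s + b • t) i)) (fun i => Real.sqrt (w i))
  have key2 := key.trans (mul_le_of_le_one_right (h.nonneg _) hw1)
  have low : Real.sqrt D ≤ Om (fun i => Real.sqrt ((a • s + b • t) i)) := by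
    refine le_trans ?_ key2
    have e1 : ∀ i, Real.sqrt (a * α) * (u i * Real.sqrt (s i)) +
        Real.sqrt (b * β) * (v i * Real.sqrt (t i)) ≤
        Real.sqrt ((a • s + b • t) i) * Real.sqrt (w i) := by
      intro i
      rw [← Real.sqrt_mul (hst i)]
      apply Real.le_sqrt_of_sq_le
      rw [Real.sqrt_mul ha, Real.sqrt_mul hb]
      simp only [hw, Pi.add_apply, Pi.smul_apply, smul_eq_mul]
      have a1 := Real.sq_sqrt ha
      have a2 := Real.sq_sqrt hb
      have a3 := Real.sq_sqrt hα0
      have a4 := Real.sq_sqrt hβ0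
      have a5 := Real.sq_sqrt (hs i)
      have a6 := Real.sq_sqrt (ht i)
      generalize Real.sqrt a = A at *
      generalize Real.sqrt b = B at *
      generalize Real.sqrt α = C at *
      generalize Real.sqrt β = E at *
      generalize Real.sqrt (s i) = X at *
      generalize Real.sqrt (t i) = Y at *
      rw [← a1, ← a2, ← a3, ← a4, ← a5, ← a6]
      nlinarith [sq_nonneg (A * X * E * v i - B * Y * C * u i)]
    have e2 : Real.sqrt D = Real.sqrt (a * α) * p + Real.sqrt (b * β) * q := by
      have r : ∀ c r : ℝ, 0 ≤ c → 0 ≤ r →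
          Real.sqrt (c * (c * r ^ 2 / D)) * r = c * r ^ 2 / Real.sqrt D := by
        intro c r hc hr
        have : c * (c * r ^ 2 / D) = (c * r) ^ 2 / D := by ring
        rw [this, Real.sqrt_div (sq_nonneg _), Real.sqrt_sq (mul_nonneg hc hr)]
        ring
      rw [hα, hβ, r a p ha hp0, r b q hb hq0, ← add_div, ← hDdef, Real.div_sqrt]
    rw [e2, hp, hq, ← hu2, ← hv2, Finset.mul_sum, Finset.mul_sum, ← Finset.sum_add_distrib]
    exact Finset.sum_le_sum fun i _ => e1 i
  have := pow_le_pow_left₀ (Real.sqrt_nonneg _) low 2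
  rwa [Real.sq_sqrt hD.le] at this

lemma a_to_b (_h : AbsNorm Om) (H : Set (Fin d → ℝ))
    (hH : ∀ x, ENNReal.ofReal ((Om x) ^ 2) =
          ⨅ η ∈ H, ∑ i, ENNReal.ofReal ((x i) ^ 2) / ENNReal.ofReal (η i)) :
    ConcaveOn ℝ {t : Fin d → ℝ | ∀ i, 0 ≤ t i}
      (fun t => (Om fun i => Real.sqrt (t i)) ^ 2) := by
  refine ⟨orthant_convex, fun s hs t ht a b ha hb hab => ?_⟩
  have hst := orthant_convex hs ht ha hb hab
  dsimp only [smul_eq_mul]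
  rw [← ENNReal.ofReal_le_ofReal_iff (sq_nonneg _), hH]
  refine le_iInf₂ fun η hη => ?_
  have g : ∀ u : Fin d → ℝ, (∀ i, 0 ≤ u i) → ENNReal.ofReal ((Om fun i => Real.sqrt (u i)) ^ 2) ≤
      ∑ i, ENNReal.ofReal (u i) / ENNReal.ofReal (η i) := by
    intro u hu
    rw [hH]
    refine (iInf₂_le η hη).trans (le_of_eq ?_)
    refine Finset.sum_congr rfl fun i _ => ?_
    rw [Real.sq_sqrt (hu i)]
  rw [ENNReal.ofReal_add (by positivity) (by positivity), ENNReal.ofReal_mul ha,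
    ENNReal.ofReal_mul hb]
  refine (add_le_add (mul_le_mul_right (g s hs) _) (mul_le_mul_right (g t ht) _)).trans
    (le_of_eq ?_)
  rw [Finset.mul_sum, Finset.mul_sum, ← Finset.sum_add_distrib]
  refine Finset.sum_congr rfl fun i _ => ?_
  rw [Real.sq_sqrt (hst i)]
  simp only [Pi.add_apply, Pi.smul_apply, smul_eq_mul]
  rw [ENNReal.ofReal_add (mul_nonneg ha (hs i)) (mul_nonneg hb (ht i)), ENNReal.ofReal_mul ha,
    ENNReal.ofReal_mul hb, ENNReal.add_div, mul_div_assoc, mul_div_assoc]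

lemma b_to_a (h : AbsNorm Om)
    (hF : ConcaveOn ℝ {t : Fin d → ℝ | ∀ i, 0 ≤ t i}
      (fun t => (Om fun i => Real.sqrt (t i)) ^ 2)) :
    ∃ H : Set (Fin d → ℝ), H.Nonempty ∧ IsClosed H ∧ Convex ℝ H ∧
        (∀ η ∈ H, ∀ i, 0 ≤ η i) ∧
        (∀ x, ENNReal.ofReal ((Om x) ^ 2) =
          ⨅ η ∈ H, ∑ i, ENNReal.ofReal ((x i) ^ 2) / ENNReal.ofReal (η i)) := by
  refine ⟨{η | (∀ i, 0 ≤ η i) ∧ ∀ s : Fin d → ℝ, Om (fun i => η i * s i) ^ 2 ≤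
    ∑ i, η i * s i ^ 2}, ⟨0, ?_⟩, ?_, ?_, fun η hη => hη.1, fun x => le_antisymm ?_ ?_⟩
  · refine ⟨fun i => le_rfl, fun s => ?_⟩
    have : (fun i => (0 : Fin d → ℝ) i * s i) = 0 := by funext i; simp
    rw [this, h.zero]; simp
  · have := h.continuous
    simp only [ofPred_and, ofPred_forall]
    refine IsClosed.inter (isClosed_iInter fun i => isClosed_le continuous_const
      (continuous_apply i)) (isClosed_iInter fun s => isClosed_le (by fun_prop) (by fun_prop))
  · intro η hη θ hθ a b ha hb hab
    refine ⟨orthant_convex hη.1 hθ.1 ha hb hab, fun s => ?_⟩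
    have h1 := hη.2 s
    have h2 := hθ.2 s
    have h3 := h.convexOn.2 (mem_univ (fun i => η i * s i)) (mem_univ (fun i => θ i * s i))
      ha hb hab
    have e : (fun i => (a • η + b • θ) i * s i) =
        a • (fun i => η i * s i) + b • (fun i => θ i * s i) := by
      funext i
      simp only [Pi.add_apply, Pi.smul_apply, smul_eq_mul]; ring
    have e2 : ∑ i, (a • η + b • θ) i * s i ^ 2 =
        a * ∑ i, η i * s i ^ 2 + b * ∑ i, θ i * s i ^ 2 := by
      rw [Finset.mul_sum, Finset.mul_sum, ← Finset.sum_add_distrib]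
      refine Finset.sum_congr rfl fun i _ => ?_
      simp only [Pi.add_apply, Pi.smul_apply, smul_eq_mul]; ring
    rw [e, e2]
    refine (pow_le_pow_left₀ (h.nonneg _) h3 2).trans ?_
    refine le_trans ?_ (add_le_add (mul_le_mul_of_nonneg_left h1 ha)
      (mul_le_mul_of_nonneg_left h2 hb))
    simp only [smul_eq_mul]
    generalize Om (fun i => η i * s i) = P
    generalize Om (fun i => θ i * s i) = Q
    have : b = 1 - a := by linarith
    subst this
    nlinarith [mul_nonneg (mul_nonneg ha hb) (sq_nonneg (P - Q))]
  · refine le_iInf₂ fun η hη => ?_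
    by_cases hz : ∃ i, η i = 0 ∧ x i ≠ 0
    · obtain ⟨i, hi1, hi2⟩ := hz
      have : ∑ i, ENNReal.ofReal ((x i) ^ 2) / ENNReal.ofReal (η i) = ⊤ := by
        rw [ENNReal.sum_eq_top]
        refine ⟨i, Finset.mem_univ _, ?_⟩
        rw [hi1, ENNReal.ofReal_zero, ENNReal.div_zero]
        have : 0 < x i ^ 2 := by positivity
        exact (ENNReal.ofReal_pos.2 this).ne'
      rw [this]; exact le_top
    · push Not at hz
      have h1 := hη.2 (fun i => x i / η i)
      have e : (fun i => η i * (x i / η i)) = x := by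
        funext i
        by_cases h0 : η i = 0
        · simp [h0, hz i h0]
        · field_simp
      rw [e] at h1
      refine (ENNReal.ofReal_le_ofReal h1).trans ?_
      rw [ENNReal.ofReal_sum_of_nonneg
        (fun i _ => mul_nonneg (hη.1 i) (sq_nonneg _))]
      refine Finset.sum_le_sum fun i _ => ?_
      rcases (hη.1 i).eq_or_lt with h0 | h0
      · simp [← h0]
      · rw [← ENNReal.ofReal_div_of_pos h0]
        apply ENNReal.ofReal_le_ofReal
        apply le_of_eq
        field_simp
  · refine ENNReal.le_of_forall_pos_le_add fun ε hε _ => ?_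
    obtain ⟨l, hl0, hl1, hl2⟩ := h.supergrad hF x (ε := ε) (by exact_mod_cast hε)
    refine (iInf₂_le (fun i => (l i)⁻¹) ⟨fun i => (inv_pos.2 (hl0 i)).le, fun s => ?_⟩).trans ?_
    · have : ∀ i, ENNReal.ofReal ((x i) ^ 2) / ENNReal.ofReal ((l i)⁻¹) =
          ENNReal.ofReal (l i * x i ^ 2) := by
        intro i
        rw [← ENNReal.ofReal_div_of_pos (inv_pos.2 (hl0 i))]
        congr 1
        rw [div_inv_eq_mul, mul_comm]
      simp only [this]
      rw [← ENNReal.ofReal_sum_of_nonneg (fun i _ => mul_nonneg (hl0 i).le (sq_nonneg _))]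
      refine (ENNReal.ofReal_le_ofReal hl2).trans ?_
      rw [ENNReal.ofReal_add (sq_nonneg _) ε.coe_nonneg]
      simp
    · refine (hl1 _).trans (le_of_eq (Finset.sum_congr rfl fun i _ => ?_))
      have := (hl0 i).ne'
      field_simp

end AbsNorm

/-- For an absolute norm `Ω` on `ℝ^d` with dual norm `Ω°`, the following are equivalent:
(a) there is a nonempty closed convex `H ⊆ ℝ₊^d` with `Ω(x)² = inf_{η ∈ H} xᵀ Diag(η)⁻¹ x`
(with the conventions `x_i²/η_i = +∞` if `η_i = 0, x_i ≠ 0`, and `0` if `η_i = x_i = 0`);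
(b) `t ↦ Ω(t^{1/2})²` is concave on `ℝ₊^d`;
(c) `t ↦ Ω°(t^{1/2})²` is convex on `ℝ₊^d`. -/
theorem statement3 {d : ℕ} (Om : (Fin d → ℝ) → ℝ)
    (h_add : ∀ x y, Om (x + y) ≤ Om x + Om y)
    (h_smul : ∀ (c : ℝ) x, Om (c • x) = |c| * Om x)
    (h_def : ∀ x, Om x = 0 → x = 0)
    (h_abs : ∀ x, Om (fun i => |x i|) = Om x) :
    ((∃ H : Set (Fin d → ℝ), H.Nonempty ∧ IsClosed H ∧ Convex ℝ H ∧
        (∀ η ∈ H, ∀ i, 0 ≤ η i) ∧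
        (∀ x, ENNReal.ofReal ((Om x) ^ 2) =
          ⨅ η ∈ H, ∑ i, ENNReal.ofReal ((x i) ^ 2) / ENNReal.ofReal (η i))) ↔
      ConcaveOn ℝ {t : Fin d → ℝ | ∀ i, 0 ≤ t i}
        (fun t => (Om fun i => Real.sqrt (t i)) ^ 2)) ∧
    (ConcaveOn ℝ {t : Fin d → ℝ | ∀ i, 0 ≤ t i}
        (fun t => (Om fun i => Real.sqrt (t i)) ^ 2) ↔
      ConvexOn ℝ {t : Fin d → ℝ | ∀ i, 0 ≤ t i}
        (fun t => (dualNorm Om fun i => Real.sqrt (t i)) ^ 2)) := by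
  have h : AbsNorm Om := ⟨h_add, h_smul, h_def, h_abs⟩
  exact ⟨⟨fun ⟨H, _, _, _, _, hH⟩ => h.a_to_b H hH, h.b_to_a⟩, ⟨h.b_to_c, h.c_to_b⟩⟩

end
end

section
/- Let U ⊂ ℝ^n be compact containing 0 in its convex hull, let V be the closed unit ℓ₂-ball of ℝ^d, let Θ be the gauge of {u vᵀ : u ∈ U, v ∈ V} on ℝ^{n×d}, and let P_U°° be the closed convex hull of {u uᵀ : u ∈ U} ∪ {0}. Then for all X, Y ∈ ℝ^{n×d}: Θ(X)² = inf_{M ∈ P_U°°} tr(Xᵀ M⁻¹ X) and (Θ°(Y))² = max_{M ∈ P_U°°} tr(M Y Yᵀ). -/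
open Matrix Set ENNReal NNReal Pointwise

noncomputable section

/-- The closed convex hull of `C ∪ {0}`. -/
def cvx {E : Type*} [AddCommGroup E] [Module ℝ E] [TopologicalSpace E] (C : Set E) : Set E :=
  closure (convexHull ℝ (insert 0 C))

/-- `P_U = {u uᵀ : u ∈ U}`. -/
def PU {n : ℕ} (U : Set (Fin n → ℝ)) : Set (Matrix (Fin n) (Fin n) ℝ) :=
  (fun u => vecMulVec u u) '' U

/-- `Θ(X)`: the gauge of `{u vᵀ : u ∈ U, v ∈ V}`. -/
def Theta {n d : ℕ} (U : Set (Fin n → ℝ)) (V : Set (Fin d → ℝ))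
    (X : Matrix (Fin n) (Fin d) ℝ) : ℝ≥0∞ :=
  sInf {t : ℝ≥0∞ | ∃ (r : ℕ) (lam : Fin r → ℝ) (u : Fin r → Fin n → ℝ)
    (v : Fin r → Fin d → ℝ),
    (∀ m, 0 ≤ lam m) ∧ (∀ m, u m ∈ U) ∧ (∀ m, v m ∈ V) ∧
    X = ∑ m, lam m • vecMulVec (u m) (v m) ∧ t = ENNReal.ofReal (∑ m, lam m)}

/-- The polar gauge of `Θ`: `Θ°(Y) = sup {tr(Xᵀ Y) : Θ(X) ≤ 1}`. -/
def ThetaPolar {n d : ℕ} (U : Set (Fin n → ℝ)) (V : Set (Fin d → ℝ))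
    (Y : Matrix (Fin n) (Fin d) ℝ) : ℝ≥0∞ :=
  ⨆ X ∈ {X | Theta U V X ≤ 1}, ENNReal.ofReal ((Xᵀ * Y).trace)

/-- The generalized quantity `tr(Xᵀ M⁻¹ X) = inf {tr N : [[M, X], [Xᵀ, N]] ⪰ 0}`. -/
def trQuadInv {n d : ℕ} (M : Matrix (Fin n) (Fin n) ℝ) (X : Matrix (Fin n) (Fin d) ℝ) :
    ℝ≥0∞ :=
  ⨅ (N : Matrix (Fin d) (Fin d) ℝ) (_ : (fromBlocks M X Xᵀ N).PosSemidef),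
    ENNReal.ofReal N.trace

lemma isCompact_hull {E : Type*} [AddCommGroup E] [Module ℝ E] [TopologicalSpace E]
    [ContinuousAdd E] [ContinuousSMul ℝ E] [FiniteDimensional ℝ E] {s : Set E}
    (hs : IsCompact s) (hne : s.Nonempty) : IsCompact (convexHull ℝ s) := by
  classical
  obtain ⟨s0, hs0⟩ := hne
  let D := Module.finrank ℝ E + 1
  let f : (Fin D → ℝ) × (Fin D → E) → E := fun p => ∑ i, p.1 i • p.2 i
  have hf : Continuous f := by
    refine continuous_finsetSum _ fun i _ => ?_
    exact ((continuous_apply i).comp continuous_fst).smul ((continuous_apply i).comp continuous_snd)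
  have hK : IsCompact ((stdSimplex ℝ (Fin D)) ×ˢ (Set.univ.pi fun _ : Fin D => s)) :=
    (isCompact_stdSimplex ℝ (Fin D)).prod (isCompact_univ_pi fun _ => hs)
  have : convexHull ℝ s = f '' ((stdSimplex ℝ (Fin D)) ×ˢ (Set.univ.pi fun _ : Fin D => s)) := by
    apply Set.Subset.antisymm
    · intro x hx
      obtain ⟨ι, _, z, w, hz, hai, hw, hw1, rfl⟩ := eq_pos_convex_span_of_mem_convexHull hx
      have hcard : Fintype.card ι ≤ Fintype.card (Fin D) := by
        rw [Fintype.card_fin]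
        exact hai.card_le_finrank_succ.trans (Nat.succ_le_succ (Submodule.finrank_le _))
      obtain ⟨e⟩ := Function.Embedding.nonempty_of_card_le hcard
      refine ⟨(Function.extend e w 0, Function.extend e z (fun _ => s0)), ⟨⟨?_, ?_⟩, ?_⟩, ?_⟩
      · intro j
        by_cases hj : ∃ i, e i = j
        · obtain ⟨i, rfl⟩ := hj
          simpa [e.injective.extend_apply] using (hw i).le
        · simp [Function.extend_apply' _ _ _ hj]
      · rw [← hw1]
        exact Fintype.sum_of_injective e e.injective w _
          (fun j hj => by simp [Function.extend_apply' _ _ _ hj])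
          (fun i => by simp [e.injective.extend_apply]) |>.symm
      · intro j _
        by_cases hj : ∃ i, e i = j
        · obtain ⟨i, rfl⟩ := hj
          simpa [e.injective.extend_apply] using hz ⟨i, rfl⟩
        · simpa [Function.extend_apply' _ _ _ hj] using hs0
      · exact Fintype.sum_of_injective e e.injective _ _
          (fun j hj => by simp [Function.extend_apply' _ _ _ hj])
          (fun i => by simp [e.injective.extend_apply]) |>.symm
    · rintro _ ⟨⟨w, z⟩, ⟨⟨h0, h1⟩, hz⟩, rfl⟩
      exact (convex_convexHull ℝ s).sum_mem (fun i _ => h0 i) h1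
        (fun i _ => subset_convexHull ℝ s (hz i (Set.mem_univ i)))
  rw [this]
  exact hK.image hf

lemma cvx_rep {n : ℕ} {U : Set (Fin n → ℝ)} (hU : IsCompact U) (hne : U.Nonempty)
    {M : Matrix (Fin n) (Fin n) ℝ} (hM : M ∈ cvx (PU U)) :
    ∃ (ι : Type) (_ : Fintype ι) (a : ι → ℝ) (u : ι → Fin n → ℝ), (∀ i, 0 ≤ a i) ∧
      ∑ i, a i ≤ 1 ∧ (∀ i, u i ∈ U) ∧ M = ∑ i, a i • vecMulVec (u i) (u i) := by
  have hc : IsCompact (insert 0 (PU U)) := by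
    refine (hU.image ?_).insert 0
    exact continuous_id.matrix_vecMulVec continuous_id
  have hcl : IsClosed (convexHull ℝ (insert 0 (PU U))) :=
    (isCompact_hull hc (Set.insert_nonempty _ _)).isClosed
  rw [cvx, hcl.closure_eq] at hM
  obtain ⟨ι, _, z, w, hz, -, hw, hw1, rfl⟩ := eq_pos_convex_span_of_mem_convexHull hM
  obtain ⟨u0, hu0⟩ := hne
  have : ∀ i, ∃ (c : ℝ) (u : Fin n → ℝ), 0 ≤ c ∧ c ≤ 1 ∧ u ∈ U ∧ z i = c • vecMulVec u u := by
    intro i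
    rcases hz ⟨i, rfl⟩ with h | ⟨u, hu, h⟩
    · exact ⟨0, u0, le_rfl, zero_le_one, hu0, by simpa using h⟩
    · exact ⟨1, u, zero_le_one, le_rfl, hu, by simpa using h.symm⟩
  choose c u h0 h1 h2 h3 using this
  refine ⟨ι, ‹_›, fun i => w i * c i, u, fun i => mul_nonneg (hw i).le (h0 i), ?_, h2, ?_⟩
  · rw [← hw1]
    exact Finset.sum_le_sum fun i _ => mul_le_of_le_one_right (hw i).le (h1 i)
  · simp [h3, mul_smul]

lemma Theta_le {n d : ℕ} {U : Set (Fin n → ℝ)} {V : Set (Fin d → ℝ)} {ι : Type} [Fintype ι]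
    (lam : ι → ℝ) (u : ι → Fin n → ℝ) (v : ι → Fin d → ℝ) (h0 : ∀ m, 0 ≤ lam m)
    (hu : ∀ m, u m ∈ U) (hv : ∀ m, v m ∈ V) :
    Theta U V (∑ m, lam m • vecMulVec (u m) (v m)) ≤ ENNReal.ofReal (∑ m, lam m) := by
  let e := (Fintype.equivFin ι).symm
  refine sInf_le ⟨Fintype.card ι, lam ∘ e, u ∘ e, v ∘ e, fun _ => h0 _, fun _ => hu _,
    fun _ => hv _, ?_, ?_⟩
  · exact (Equiv.sum_comp e (fun m => lam m • vecMulVec (u m) (v m))).symm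
  · exact congrArg _ (Equiv.sum_comp e lam).symm

/-- The block quadratic form. -/
lemma block_form {n d : ℕ} {M : Matrix (Fin n) (Fin n) ℝ} {X : Matrix (Fin n) (Fin d) ℝ}
    {N : Matrix (Fin d) (Fin d) ℝ} (h : (fromBlocks M X Xᵀ N).PosSemidef)
    (a : Fin n → ℝ) (b : Fin d → ℝ) :
    0 ≤ a ⬝ᵥ M *ᵥ a + 2 * (a ⬝ᵥ X *ᵥ b) + b ⬝ᵥ N *ᵥ b := by
  have := h.dotProduct_mulVec_nonneg (Sum.elim a b)
  rw [fromBlocks_mulVec] at this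
  have e : star (Sum.elim a b) = Sum.elim a b := by ext; simp
  rw [e, sumElim_dotProduct_sumElim] at this
  have e2 : b ⬝ᵥ Xᵀ *ᵥ a = a ⬝ᵥ X *ᵥ b := by
    rw [mulVec_transpose, dotProduct_comm, ← dotProduct_mulVec]
  simp only [Sum.elim_comp_inl, Sum.elim_comp_inr, dotProduct_add, e2] at this
  linarith

lemma exists_preimage {n : ℕ} {M : Matrix (Fin n) (Fin n) ℝ} (hM : Mᵀ = M) (x : Fin n → ℝ)
    (h : ∀ w, M *ᵥ w = 0 → w ⬝ᵥ x = 0) : ∃ k, M *ᵥ k = x := by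
  by_contra hcon
  have hx : x ∉ LinearMap.range M.mulVecLin := by
    rintro ⟨k, hk⟩
    exact hcon ⟨k, hk⟩
  obtain ⟨f, hf, hf2⟩ := Submodule.exists_dual_map_eq_bot_of_notMem hx inferInstance
  obtain ⟨w, hw⟩ : ∃ w : Fin n → ℝ, ∀ y, f y = w ⬝ᵥ y := by
    refine ⟨(dotProductEquiv ℝ (Fin n)).symm f, fun y => ?_⟩
    conv_lhs => rw [← (dotProductEquiv ℝ (Fin n)).apply_symm_apply f]
    rfl
  apply hf
  rw [hw]
  apply h
  have : ∀ y, w ⬝ᵥ M *ᵥ y = 0 := by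
    intro y
    rw [← hw]
    have : f (M.mulVecLin y) ∈ (LinearMap.range M.mulVecLin).map f :=
      Submodule.mem_map_of_mem ⟨y, rfl⟩
    rw [hf2] at this
    simpa using this
  have h2 := this (M *ᵥ w)
  rw [dotProduct_mulVec, ← mulVec_transpose, hM] at h2
  exact dotProduct_self_eq_zero.1 h2

lemma exists_K {n d : ℕ} {M : Matrix (Fin n) (Fin n) ℝ} {X : Matrix (Fin n) (Fin d) ℝ}
    {N : Matrix (Fin d) (Fin d) ℝ} (hM : Mᵀ = M) (h : (fromBlocks M X Xᵀ N).PosSemidef) :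
    ∃ k : Fin d → Fin n → ℝ, ∀ j, M *ᵥ k j = X.col j := by
  have : ∀ j, ∃ k, M *ᵥ k = X.col j := by
    intro j
    refine exists_preimage hM _ fun w hw => ?_
    have key : ∀ t : ℝ, 0 ≤ 2 * t * (w ⬝ᵥ X.col j) + N j j := by
      intro t
      have := block_form h (t • w) (Pi.single j 1)
      simp only [mulVec_smul, hw, smul_zero, dotProduct_zero, mulVec_single_one, smul_dotProduct,
        single_one_dotProduct, smul_eq_mul] at this
      simp only [col_apply] at this
      linarith
    by_contra hne
    have := key (-(N j j + 1) / (2 * (w ⬝ᵥ X.col j)))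
    field_simp at this
    linarith
  choose k hk using this
  exact ⟨k, hk⟩

lemma Theta_sq_le {n d : ℕ} {U : Set (Fin n → ℝ)} (hU : IsCompact U) (hne : U.Nonempty)
    {M : Matrix (Fin n) (Fin n) ℝ} (hM : M ∈ cvx (PU U)) {X : Matrix (Fin n) (Fin d) ℝ}
    {N : Matrix (Fin d) (Fin d) ℝ} (h : (fromBlocks M X Xᵀ N).PosSemidef) :
    (Theta U {v : Fin d → ℝ | v ⬝ᵥ v ≤ 1} X) ^ 2 ≤ ENNReal.ofReal N.trace := by
  obtain ⟨ι, _, a, u, ha, ha1, hu, rfl⟩ := cvx_rep hU hne hM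
  set M := ∑ i, a i • vecMulVec (u i) (u i) with hMdef
  have hMs : Mᵀ = M := by
    simp [hMdef, transpose_sum, transpose_smul, transpose_vecMulVec]
  obtain ⟨k, hk⟩ := exists_K hMs h
  have hMv : ∀ y, M *ᵥ y = ∑ i, (a i * (u i ⬝ᵥ y)) • u i := by
    intro y
    rw [hMdef, sum_mulVec]
    refine Finset.sum_congr rfl fun i _ => ?_
    rw [smul_mulVec, vecMulVec_mulVec]
    ext l
    simp
    ring
  -- `g i j = u i ⬝ k j`
  let g : ι → Fin d → ℝ := fun i j => u i ⬝ᵥ k j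
  let b : ι → ℝ := fun i => √(g i ⬝ᵥ g i)
  have hgg : ∀ i, 0 ≤ g i ⬝ᵥ g i := fun i => Finset.sum_nonneg fun j _ => mul_self_nonneg _
  have hb : ∀ i, b i * b i = g i ⬝ᵥ g i := fun i => Real.mul_self_sqrt (hgg i)
  have hb0 : ∀ i, b i = 0 → g i = 0 := by
    intro i hi
    have := hb i
    rw [hi, zero_mul] at this
    exact dotProduct_self_eq_zero.1 this.symm
  have hXe : X = ∑ i, (a i * b i) • vecMulVec (u i) ((b i)⁻¹ • g i) := by
    ext l j
    have : X l j = (M *ᵥ k j) l := by rw [hk]; rfl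
    rw [this, hMv, Matrix.sum_apply, Finset.sum_apply]
    refine Finset.sum_congr rfl fun i _ => ?_
    simp only [Pi.smul_apply, smul_eq_mul, Matrix.smul_apply, vecMulVec_apply]
    by_cases hi : b i = 0
    · have : u i ⬝ᵥ k j = 0 := congrFun (hb0 i hi) j
      simp [hi, this]
    · field_simp
      simp only [g]
      ring
  have hle : Theta U {v : Fin d → ℝ | v ⬝ᵥ v ≤ 1} X ≤ ENNReal.ofReal (∑ i, a i * b i) := by
    rw [hXe]
    refine Theta_le _ _ _ (fun i => mul_nonneg (ha i) (Real.sqrt_nonneg _)) hu fun i => ?_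
    change ((b i)⁻¹ • g i) ⬝ᵥ ((b i)⁻¹ • g i) ≤ 1
    rw [smul_dotProduct, dotProduct_smul, ← hb, smul_eq_mul, smul_eq_mul]
    by_cases hi : b i = 0
    · simp [hi]
    · apply le_of_eq
      field_simp
  have htr : ∑ i, a i * (b i * b i) ≤ N.trace := by
    have h1 : ∑ i, a i * (b i * b i) = ∑ j, ∑ i, a i * (g i j * g i j) := by
      rw [Finset.sum_comm]
      refine Finset.sum_congr rfl fun i _ => ?_
      rw [hb, dotProduct, Finset.mul_sum]
    rw [h1, Matrix.trace]
    refine Finset.sum_le_sum fun j _ => ?_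
    have h2 := block_form h (-k j) (Pi.single j 1)
    have h3 : k j ⬝ᵥ M *ᵥ k j = ∑ i, a i * (g i j * g i j) := by
      rw [hMv, dotProduct_sum]
      refine Finset.sum_congr rfl fun i _ => ?_
      rw [dotProduct_smul, dotProduct_comm (k j), smul_eq_mul, mul_assoc]
    simp only [mulVec_neg, neg_dotProduct, dotProduct_neg, neg_neg, mulVec_single_one, ← hk, h3,
      single_one_dotProduct] at h2
    simp only [col_apply] at h2
    simp only [diag_apply]
    linarith
  have hsq : (∑ i, a i * b i) ^ 2 ≤ N.trace := by
    have hcs := Finset.sum_mul_sq_le_sq_mul_sq Finset.univ (fun i => √(a i)) (fun i => √(a i) * b i)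
    have e1 : ∀ i, √(a i) * (√(a i) * b i) = a i * b i := fun i => by
      rw [← mul_assoc, Real.mul_self_sqrt (ha i)]
    have e2 : ∀ i, √(a i) ^ 2 = a i := fun i => Real.sq_sqrt (ha i)
    simp only [e1, mul_pow, e2] at hcs
    refine hcs.trans ?_
    have : 0 ≤ ∑ i, a i * b i ^ 2 := Finset.sum_nonneg fun i _ => mul_nonneg (ha i) (sq_nonneg _)
    refine (mul_le_of_le_one_left this ha1).trans ?_
    simpa only [sq] using htr
  calc _ ≤ (ENNReal.ofReal (∑ i, a i * b i)) ^ 2 := pow_le_pow_left₀ zero_le hle 2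
    _ = ENNReal.ofReal ((∑ i, a i * b i) ^ 2) := (ENNReal.ofReal_pow
        (Finset.sum_nonneg fun i _ => mul_nonneg (ha i) (Real.sqrt_nonneg _)) 2).symm
    _ ≤ _ := ENNReal.ofReal_le_ofReal hsq

lemma block_psd {n d : ℕ} (u : Fin n → ℝ) (v : Fin d → ℝ) :
    (fromBlocks (vecMulVec u u) (vecMulVec u v) (vecMulVec v u) (vecMulVec v v)).PosSemidef := by
  have := posSemidef_vecMulVec_self_star (Sum.elim u v)
  convert this using 1
  ext i j
  rcases i with i | i <;> rcases j with j | j <;> simp [vecMulVec_apply]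

lemma inf_le_sq {n d : ℕ} {U : Set (Fin n → ℝ)} {r : ℕ} (lam : Fin r → ℝ)
    (u : Fin r → Fin n → ℝ) (v : Fin r → Fin d → ℝ) (h0 : ∀ m, 0 ≤ lam m)
    (hu : ∀ m, u m ∈ U) (hv : ∀ m, v m ⬝ᵥ v m ≤ 1) :
    (⨅ M ∈ cvx (PU U), trQuadInv M (∑ m, lam m • vecMulVec (u m) (v m))) ≤
      (ENNReal.ofReal (∑ m, lam m)) ^ 2 := by
  set s := ∑ m, lam m with hs
  have hs0 : 0 ≤ s := Finset.sum_nonneg fun m _ => h0 m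
  rcases hs0.eq_or_lt with hz | hpos
  · have hl : ∀ m, lam m = 0 := fun m =>
      (Finset.sum_eq_zero_iff_of_nonneg (fun m _ => h0 m)).1 hz.symm m (Finset.mem_univ m)
    have hX : ∑ m, lam m • vecMulVec (u m) (v m) = 0 := by simp [hl]
    rw [hX]
    refine (iInf₂_le (0 : Matrix (Fin n) (Fin n) ℝ)
      (subset_closure (subset_convexHull ℝ _ (Set.mem_insert _ _)))).trans ?_
    refine (iInf₂_le (0 : Matrix (Fin d) (Fin d) ℝ) ?_).trans ?_
    · rw [transpose_zero, fromBlocks_zero]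
      exact PosSemidef.zero
    · simp
  · refine (iInf₂_le (∑ m, (lam m / s) • vecMulVec (u m) (u m)) ?_).trans ?_
    · refine subset_closure ((convex_convexHull ℝ _).sum_mem (fun m _ => div_nonneg (h0 m) hs0) ?_
        fun m _ => subset_convexHull ℝ _ (Set.mem_insert_of_mem _ ⟨u m, hu m, rfl⟩))
      rw [← Finset.sum_div, ← hs, div_self hpos.ne']
    refine (iInf₂_le (∑ m, (s * lam m) • vecMulVec (v m) (v m)) ?_).trans ?_
    · have : fromBlocks (∑ m, (lam m / s) • vecMulVec (u m) (u m))
          (∑ m, lam m • vecMulVec (u m) (v m)) (∑ m, lam m • vecMulVec (u m) (v m))ᵀ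
          (∑ m, (s * lam m) • vecMulVec (v m) (v m)) =
          ∑ m, (lam m / s) • fromBlocks (vecMulVec (u m) (u m)) (vecMulVec (u m) (s • v m))
            (vecMulVec (s • v m) (u m)) (vecMulVec (s • v m) (s • v m)) := by
        ext i j
        rcases i with i | i <;> rcases j with j | j <;>
          simp only [fromBlocks_apply₁₁, fromBlocks_apply₁₂, fromBlocks_apply₂₁,
            fromBlocks_apply₂₂, transpose_apply, Matrix.sum_apply, Matrix.smul_apply,
            vecMulVec_apply, smul_eq_mul, Pi.smul_apply] <;>
          refine Finset.sum_congr rfl fun m _ => ?_ <;> field_simp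
      rw [this]
      exact posSemidef_sum _ fun m _ => (block_psd _ _).smul (div_nonneg (h0 m) hs0)
    · rw [← ENNReal.ofReal_pow hs0]
      refine ENNReal.ofReal_le_ofReal ?_
      rw [trace_sum, sq]
      conv_rhs => rw [hs, Finset.mul_sum]
      refine Finset.sum_le_sum fun m _ => ?_
      rw [trace_smul, trace_vecMulVec, smul_eq_mul]
      exact mul_le_of_le_one_right (mul_nonneg hs0 (h0 m)) (hv m)

lemma trace_form {n d : ℕ} (u : Fin n → ℝ) (v : Fin d → ℝ) (Y : Matrix (Fin n) (Fin d) ℝ) :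
    ((vecMulVec u v)ᵀ * Y).trace = v ⬝ᵥ (u ᵥ* Y) := by
  rw [transpose_vecMulVec, vecMulVec_mul, trace_vecMulVec]

lemma trace_form2 {n d : ℕ} (u : Fin n → ℝ) (Y : Matrix (Fin n) (Fin d) ℝ) :
    (vecMulVec u u * Y * Yᵀ).trace = (u ᵥ* Y) ⬝ᵥ (u ᵥ* Y) := by
  rw [vecMulVec_mul, vecMulVec_mul, trace_vecMulVec, vecMul_transpose, dotProduct_mulVec]

lemma polar_le {n d : ℕ} {U : Set (Fin n → ℝ)} {Y : Matrix (Fin n) (Fin d) ℝ} {c : ℝ}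
    (hc : 0 ≤ c) (h : ∀ u ∈ U, (u ᵥ* Y) ⬝ᵥ (u ᵥ* Y) ≤ c ^ 2) :
    ThetaPolar U {v : Fin d → ℝ | v ⬝ᵥ v ≤ 1} Y ≤ ENNReal.ofReal c := by
  refine iSup₂_le fun X hX => ENNReal.ofReal_le_ofReal ?_
  have key : ∀ ε : ℝ, 0 < ε → (Xᵀ * Y).trace ≤ (1 + ε) * c := by
    intro ε hε
    have hlt : Theta U {v : Fin d → ℝ | v ⬝ᵥ v ≤ 1} X < ENNReal.ofReal (1 + ε) :=
      lt_of_le_of_lt hX (by rw [← ENNReal.ofReal_one]; exact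
        (ENNReal.ofReal_lt_ofReal_iff (by linarith)).2 (by linarith))
    obtain ⟨t, ⟨r, lam, u, v, h0, hu, hv, rfl, rfl⟩, ht⟩ := sInf_lt_iff.1 hlt
    have hs : ∑ m, lam m ≤ 1 + ε := ((ENNReal.ofReal_lt_ofReal_iff (by linarith)).1 ht).le
    refine le_trans ?_ (mul_le_mul_of_nonneg_right hs hc)
    rw [transpose_sum, Matrix.sum_mul, trace_sum, Finset.sum_mul]
    refine Finset.sum_le_sum fun m _ => ?_
    rw [transpose_smul, Matrix.smul_mul, trace_smul, trace_form, smul_eq_mul]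
    refine mul_le_mul_of_nonneg_left ?_ (h0 m)
    have hcs := Finset.sum_mul_sq_le_sq_mul_sq Finset.univ (v m) (u m ᵥ* Y)
    have e1 : ∑ i, v m i ^ 2 ≤ 1 := by
      have := hv m
      simpa [dotProduct, sq] using this
    have e2 : ∑ i, (u m ᵥ* Y) i ^ 2 ≤ c ^ 2 := by
      have := h _ (hu m)
      simpa only [dotProduct, ← sq] using this
    refine abs_le_of_sq_le_sq' ?_ hc |>.2
    refine hcs.trans ?_
    refine (mul_le_of_le_one_left (Finset.sum_nonneg fun i _ => sq_nonneg _) e1).trans e2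
  refine le_of_forall_pos_le_add fun δ hδ => ?_
  have := key (δ / (c + 1)) (by positivity)
  have h2 : δ / (c + 1) * c ≤ δ := by
    rw [div_mul_eq_mul_div, div_le_iff₀ (by positivity)]
    nlinarith
  linarith

lemma le_polar {n d : ℕ} {U : Set (Fin n → ℝ)} {Y : Matrix (Fin n) (Fin d) ℝ} {p : ℝ}
    (hp : 0 ≤ p) (h : ThetaPolar U {v : Fin d → ℝ | v ⬝ᵥ v ≤ 1} Y ≤ ENNReal.ofReal p)
    {M : Matrix (Fin n) (Fin n) ℝ} (hM : M ∈ cvx (PU U)) : (M * Y * Yᵀ).trace ≤ p ^ 2 := by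
  have hcont : Continuous fun M : Matrix (Fin n) (Fin n) ℝ => (M * Y * Yᵀ).trace := by fun_prop
  have hclosed : IsClosed {M : Matrix (Fin n) (Fin n) ℝ | (M * Y * Yᵀ).trace ≤ p ^ 2} :=
    isClosed_le hcont continuous_const
  have hconv : Convex ℝ {M : Matrix (Fin n) (Fin n) ℝ | (M * Y * Yᵀ).trace ≤ p ^ 2} := by
    refine convex_halfSpace_le ⟨fun A B => ?_, fun c A => ?_⟩ _
    · simp [Matrix.add_mul]
    · simp
  refine closure_minimal (convexHull_min ?_ hconv) hclosed hM
  rintro A (rfl | ⟨u, hu, rfl⟩)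
  · simp [sq_nonneg]
  · change (vecMulVec u u * Y * Yᵀ).trace ≤ p ^ 2
    rw [trace_form2]
    set g := u ᵥ* Y with hg
    have hgg : 0 ≤ g ⬝ᵥ g := Finset.sum_nonneg fun j _ => mul_self_nonneg _
    set b := √(g ⬝ᵥ g) with hbdef
    have hb : b * b = g ⬝ᵥ g := Real.mul_self_sqrt hgg
    have hbn : 0 ≤ b := Real.sqrt_nonneg _
    rcases hbn.eq_or_lt with hz | hpos
    · rw [← hb, ← hz]
      simp [sq_nonneg]
    have hT : Theta U {v : Fin d → ℝ | v ⬝ᵥ v ≤ 1} (vecMulVec u (b⁻¹ • g)) ≤ 1 := by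
      have := Theta_le (U := U) (V := {v : Fin d → ℝ | v ⬝ᵥ v ≤ 1}) (ι := Unit) (fun _ => 1)
        (fun _ => u) (fun _ => b⁻¹ • g) (fun _ => zero_le_one) (fun _ => hu) (fun _ => by
          change (b⁻¹ • g) ⬝ᵥ (b⁻¹ • g) ≤ 1
          rw [smul_dotProduct, dotProduct_smul, ← hb, smul_eq_mul, smul_eq_mul]
          apply le_of_eq
          field_simp)
      simpa using this
    have h1 : ENNReal.ofReal b ≤ ENNReal.ofReal p := by
      refine le_trans ?_ h
      refine le_trans (le_of_eq ?_) (le_iSup₂ (f := fun X (_ : X ∈ {X | Theta U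
        {v : Fin d → ℝ | v ⬝ᵥ v ≤ 1} X ≤ 1}) => ENNReal.ofReal ((Xᵀ * Y).trace)) _ hT)
      simp only [trace_form]
      rw [← hg, smul_dotProduct, ← hb, smul_eq_mul]
      congr 1
      field_simp
    have h2 : b ≤ p := (ENNReal.ofReal_le_ofReal_iff hp).1 h1
    rw [← hb, sq]
    exact mul_le_mul h2 h2 hbn hp

/-- For `U` compact containing `0` in its convex hull and `V` the unit `ℓ₂`-ball,
`Θ(X)² = inf_{M ∈ P_U°°} tr(Xᵀ M⁻¹ X)` and `Θ°(Y)² = max_{M ∈ P_U°°} tr(M Y Yᵀ)`,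
where `P_U°°` is the closed convex hull of `{u uᵀ : u ∈ U} ∪ {0}`. -/
theorem statement9 {n d : ℕ} (U : Set (Fin n → ℝ)) (hU : IsCompact U)
    (hU0 : (0 : Fin n → ℝ) ∈ convexHull ℝ U)
    (X Y : Matrix (Fin n) (Fin d) ℝ) :
    (Theta U {v : Fin d → ℝ | v ⬝ᵥ v ≤ 1} X) ^ 2 = (⨅ M ∈ cvx (PU U), trQuadInv M X) ∧
    (ThetaPolar U {v : Fin d → ℝ | v ⬝ᵥ v ≤ 1} Y) ^ 2 =
      (⨆ M ∈ cvx (PU U), ENNReal.ofReal ((M * Y * Yᵀ).trace)) := by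
  have hne : U.Nonempty := by
    rw [← convexHull_nonempty_iff (𝕜 := ℝ)]
    exact ⟨0, hU0⟩
  refine ⟨le_antisymm ?_ ?_, le_antisymm ?_ ?_⟩
  · exact le_iInf₂ fun M hM => le_iInf₂ fun N hN => Theta_sq_le hU hne hM hN
  · rw [← ENNReal.rpow_natCast, ← ENNReal.rpow_inv_le_iff (by norm_num)]
    refine le_sInf ?_
    rintro t ⟨r, lam, u, v, h0, hu, hv, rfl, rfl⟩
    rw [ENNReal.rpow_inv_le_iff (by norm_num), ENNReal.rpow_natCast]
    exact inf_le_sq lam u v h0 hu hv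
  · set R := (⨆ M ∈ cvx (PU U), ENNReal.ofReal ((M * Y * Yᵀ).trace)) with hR
    by_cases hT : R = ⊤
    · rw [hT]; exact le_top
    have hle : ThetaPolar U {v : Fin d → ℝ | v ⬝ᵥ v ≤ 1} Y ≤ ENNReal.ofReal √R.toReal := by
      refine polar_le (Real.sqrt_nonneg _) fun u hu => ?_
      rw [Real.sq_sqrt ENNReal.toReal_nonneg, ← trace_form2, ← ENNReal.ofReal_le_iff_le_toReal hT]
      exact le_iSup₂ (f := fun M (_ : M ∈ cvx (PU U)) => ENNReal.ofReal ((M * Y * Yᵀ).trace)) _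
        (subset_closure (subset_convexHull ℝ _ (Set.mem_insert_of_mem _ ⟨u, hu, rfl⟩)))
    calc _ ≤ (ENNReal.ofReal √R.toReal) ^ 2 := pow_le_pow_left₀ zero_le hle 2
      _ = R := by
        rw [← ENNReal.ofReal_pow (Real.sqrt_nonneg _), Real.sq_sqrt ENNReal.toReal_nonneg,
          ENNReal.ofReal_toReal hT]
  · set P := ThetaPolar U {v : Fin d → ℝ | v ⬝ᵥ v ≤ 1} Y with hP
    by_cases hT : P = ⊤
    · rw [hT]; simp
    refine iSup₂_le fun M hM => ?_
    have := le_polar (U := U) (Y := Y) (p := P.toReal) ENNReal.toReal_nonneg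
      (by rw [ENNReal.ofReal_toReal hT]) hM
    calc _ ≤ ENNReal.ofReal (P.toReal ^ 2) := ENNReal.ofReal_le_ofReal this
      _ = P ^ 2 := by
        rw [ENNReal.ofReal_pow ENNReal.toReal_nonneg, ENNReal.ofReal_toReal hT]

end
end

section
/- Let U ⊂ ℝ^n be compact with compact polar U° (equivalently, the gauge γ_U has full domain and the gauge is definite), and let V be the unit ℓ₂-ball of ℝ^d; let Θ be the gauge of {uvᵀ : u ∈ U, v ∈ V} with polar Θ°. Let w_1, …, w_r be independent standard Gaussian vectors in ℝ^n and set u_i = w_i / γ_U(w_i). If r ≥ 4n, then with probability at least 1 − e^{−r/50}, setting κ = 4√n · (max_{Θ(Z) ≤ 1} ‖Z‖_F) · (max_{‖u‖₂ ≤ 1} γ_U(u)), one has for every Y ∈ ℝ^{n×d}: (Θ°(Y))² ≥ max_{1 ≤ i ≤ r} u_iᵀ Y Yᵀ u_i ≥ (1/κ²)·(Θ°(Y))². -/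
open Matrix Set ENNReal NNReal Pointwise MeasureTheory ProbabilityTheory

noncomputable section

/-- The (possibly infinite) gauge of the closed convex hull of `C ∪ {0}`. -/
def gaugeE {E : Type*} [AddCommGroup E] [Module ℝ E] [TopologicalSpace E] (C : Set E) (x : E) :
    ℝ≥0∞ :=
  ⨅ (r : ℝ≥0) (_ : x ∈ (r : ℝ) • cvx C), (r : ℝ≥0∞)

/-- The real-valued gauge `γ_C`. -/
def gaugeR {E : Type*} [AddCommGroup E] [Module ℝ E] [TopologicalSpace E] (C : Set E) (x : E) :
    ℝ :=
  (gaugeE C x).toReal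

/-- One-sided polar of a set of vectors. -/
def vpolar {m : ℕ} (C : Set (Fin m → ℝ)) : Set (Fin m → ℝ) :=
  {y | ∀ x ∈ C, x ⬝ᵥ y ≤ 1}

/-- `Θ(X)` for `V` the unit `ℓ₂`-ball: the gauge of `{u vᵀ : u ∈ U, ‖v‖₂ ≤ 1}`. -/
def ThetaL2 {n d : ℕ} (U : Set (Fin n → ℝ)) (X : Matrix (Fin n) (Fin d) ℝ) : ℝ≥0∞ :=
  sInf {t : ℝ≥0∞ | ∃ (r : ℕ) (lam : Fin r → ℝ) (u : Fin r → Fin n → ℝ)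
    (v : Fin r → Fin d → ℝ),
    (∀ m, 0 ≤ lam m) ∧ (∀ m, u m ∈ U) ∧ (∀ m, v m ⬝ᵥ v m ≤ 1) ∧
    X = ∑ m, lam m • vecMulVec (u m) (v m) ∧ t = ENNReal.ofReal (∑ m, lam m)}

/-- `Θ°(Y) = max_{u ∈ U, ‖v‖₂ ≤ 1} uᵀ Y v`. -/
def ThetaPolarL2 {n d : ℕ} (U : Set (Fin n → ℝ)) (Y : Matrix (Fin n) (Fin d) ℝ) : ℝ :=
  sSup {t : ℝ | ∃ u ∈ U, ∃ v : Fin d → ℝ, v ⬝ᵥ v ≤ 1 ∧ t = u ⬝ᵥ Y.mulVec v}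

/-- The constant `κ = 4 √n (max_{Θ(Z) ≤ 1} ‖Z‖_F)(max_{‖u‖₂ ≤ 1} γ_U(u))`. -/
def kappa17 {n d : ℕ} (U : Set (Fin n → ℝ)) : ℝ :=
  4 * Real.sqrt n *
    sSup {t : ℝ | ∃ Z : Matrix (Fin n) (Fin d) ℝ, ThetaL2 U Z ≤ 1 ∧
      t = Real.sqrt ((Zᵀ * Z).trace)} *
    sSup {t : ℝ | ∃ u : Fin n → ℝ, u ⬝ᵥ u ≤ 1 ∧ t = gaugeR U u}

/-! ### Deterministic part -/

lemma s17_cs {m : ℕ} (x y : Fin m → ℝ) : (x ⬝ᵥ y) ^ 2 ≤ (x ⬝ᵥ x) * (y ⬝ᵥ y) := by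
  have := Finset.sum_mul_sq_le_sq_mul_sq Finset.univ x y
  simpa [dotProduct, pow_two] using this

lemma s17_dot_nonneg {m : ℕ} (x : Fin m → ℝ) : 0 ≤ x ⬝ᵥ x :=
  Finset.sum_nonneg fun i _ => mul_self_nonneg (x i)

lemma s17_dot_pos {m : ℕ} {x : Fin m → ℝ} (hx : x ≠ 0) : 0 < x ⬝ᵥ x :=
  lt_of_le_of_ne (s17_dot_nonneg x) fun h => hx (dotProduct_self_eq_zero.1 h.symm)

/-- Euclidean bound on a compact set. -/
lemma s17_bdd {m : ℕ} {U : Set (Fin m → ℝ)} (hU : IsCompact U) :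
    ∃ B : ℝ, 0 < B ∧ ∀ u ∈ U, u ⬝ᵥ u ≤ B ^ 2 := by
  have hc : Continuous fun u : Fin m → ℝ => u ⬝ᵥ u := by
    unfold dotProduct; fun_prop
  obtain ⟨B, hB⟩ := (hU.image hc).bddAbove
  refine ⟨|B| + 1, by positivity, fun u hu => ?_⟩
  have := hB (mem_image_of_mem _ hu)
  nlinarith [le_abs_self B, abs_nonneg B]

lemma s17_U_nonempty {m : ℕ} {U : Set (Fin m → ℝ)} (h : (0 : Fin m → ℝ) ∈ convexHull ℝ U) :
    U.Nonempty := by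
  rw [← convexHull_nonempty_iff (𝕜 := ℝ)]; exact ⟨_, h⟩

lemma s17_polar_bddAbove {n d : ℕ} {U : Set (Fin n → ℝ)} (hU : IsCompact U)
    (Y : Matrix (Fin n) (Fin d) ℝ) :
    BddAbove {t : ℝ | ∃ u ∈ U, ∃ v : Fin d → ℝ, v ⬝ᵥ v ≤ 1 ∧ t = u ⬝ᵥ Y.mulVec v} := by
  obtain ⟨B, hB0, hB⟩ := s17_bdd hU
  refine ⟨B * Real.sqrt (∑ j, ((fun i => Yᵀ i) j) ⬝ᵥ ((fun i => Yᵀ i) j)) + B, ?_⟩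
  rintro t ⟨u, hu, v, hv, rfl⟩
  set F := ∑ j, ((fun i => Yᵀ i) j) ⬝ᵥ ((fun i => Yᵀ i) j) with hF
  have hF0 : 0 ≤ F := Finset.sum_nonneg fun j _ => s17_dot_nonneg _
  have e : u ⬝ᵥ Y.mulVec v = (Yᵀ.mulVec u) ⬝ᵥ v := by
    rw [mulVec_transpose, dotProduct_mulVec]
  have h1 : (Yᵀ.mulVec u) ⬝ᵥ (Yᵀ.mulVec u) ≤ F * B ^ 2 := by
    rw [hF, Finset.sum_mul]
    simp only [dotProduct, mulVec]
    refine Finset.sum_le_sum fun j _ => ?_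
    have := s17_cs (Yᵀ j) u
    have h2 := hB u hu
    have h3 := s17_dot_nonneg (Yᵀ j)
    simp only [dotProduct] at this h2 h3 ⊢
    nlinarith
  have h2 := s17_cs (Yᵀ.mulVec u) v
  have h3 := s17_dot_nonneg (Yᵀ.mulVec u)
  have h4 := s17_dot_nonneg v
  rw [e]
  have h5 : ((Yᵀ.mulVec u) ⬝ᵥ v) ^ 2 ≤ (B * Real.sqrt F) ^ 2 := by
    rw [mul_pow, Real.sq_sqrt hF0]; nlinarith
  have := abs_le_of_sq_le_sq' h5 (by positivity)
  linarith [this.2]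

lemma s17_polar_nonneg {n d : ℕ} {U : Set (Fin n → ℝ)} (hU : IsCompact U)
    (h0 : U.Nonempty) (Y : Matrix (Fin n) (Fin d) ℝ) : 0 ≤ ThetaPolarL2 U Y := by
  obtain ⟨u, hu⟩ := h0
  exact le_csSup (s17_polar_bddAbove hU Y) ⟨u, hu, 0, by simp, by simp⟩

lemma s17_le_polar {n d : ℕ} {U : Set (Fin n → ℝ)} (hU : IsCompact U)
    (h0 : U.Nonempty) (Y : Matrix (Fin n) (Fin d) ℝ) (v : Fin d → ℝ) (hv : v ⬝ᵥ v ≤ 1)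
    (c : Fin n → ℝ) (hc : c ∈ cvx U) : c ⬝ᵥ Y.mulVec v ≤ ThetaPolarL2 U Y := by
  have hcl : IsClosed {c : Fin n → ℝ | c ⬝ᵥ Y.mulVec v ≤ ThetaPolarL2 U Y} := by
    refine isClosed_le ?_ continuous_const
    unfold dotProduct; fun_prop
  have hcv : Convex ℝ {c : Fin n → ℝ | c ⬝ᵥ Y.mulVec v ≤ ThetaPolarL2 U Y} := by
    refine convex_halfSpace_le ⟨?_, ?_⟩ _
    · intro x y; exact add_dotProduct _ _ _
    · intro a x; exact smul_dotProduct _ _ _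
  refine (closure_minimal (convexHull_min ?_ hcv) hcl) hc
  rintro x (rfl | hx)
  · simpa using s17_polar_nonneg hU h0 Y
  · exact le_csSup (s17_polar_bddAbove hU Y) ⟨x, hx, v, hv, rfl⟩

/-- For every `w`, `⟨w, Yv⟩ ≤ γ(w) Θ°(Y)` when the gauge is finite. -/
lemma s17_le_gauge {n d : ℕ} {U : Set (Fin n → ℝ)} (hU : IsCompact U)
    (h0 : U.Nonempty) (Y : Matrix (Fin n) (Fin d) ℝ) (v : Fin d → ℝ) (hv : v ⬝ᵥ v ≤ 1)
    (w : Fin n → ℝ) (hw : gaugeE U w ≠ ⊤) :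
    w ⬝ᵥ Y.mulVec v ≤ gaugeR U w * ThetaPolarL2 U Y := by
  have hT := s17_polar_nonneg hU h0 Y
  refine le_of_forall_pos_le_add fun ε hε => ?_
  set T := ThetaPolarL2 U Y
  have hlt : gaugeE U w < gaugeE U w + ENNReal.ofReal (ε / (T + 1)) := by
    refine ENNReal.lt_add_right hw ?_
    have : 0 < ε / (T + 1) := by positivity
    simpa using this
  have h1 : ∃ p : ℝ≥0, w ∈ (p : ℝ) • cvx U ∧ (p : ℝ≥0∞) < gaugeE U w + ENNReal.ofReal (ε / (T + 1)) := by
    conv at hlt => lhs; unfold gaugeE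
    simp only [iInf_lt_iff] at hlt
    obtain ⟨p, hp, h⟩ := hlt
    exact ⟨p, hp, h⟩
  obtain ⟨p, ⟨c, hc, rfl⟩, hp⟩ := h1
  have hp' : (p : ℝ) ≤ gaugeR U ((p : ℝ) • c) + ε / (T + 1) := by
    have := ENNReal.toReal_mono (by simp [hw]) hp.le
    rw [ENNReal.toReal_add hw (by simp), ENNReal.toReal_ofReal (by positivity)] at this
    simpa [gaugeR] using this
  have h2 := s17_le_polar hU h0 Y v hv c hc
  have h3 : ((p : ℝ) • c) ⬝ᵥ Y.mulVec v = p * (c ⬝ᵥ Y.mulVec v) := by simp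
  show ((p : ℝ) • c) ⬝ᵥ Y.mulVec v ≤ _
  rw [h3]
  have h4 : (p : ℝ) * (c ⬝ᵥ Y.mulVec v) ≤ p * T := by gcongr
  have h5 : (p : ℝ) * T ≤ (gaugeR U ((p : ℝ) • c) + ε / (T + 1)) * T := by gcongr
  have h6 : ε / (T + 1) * T ≤ ε := by
    rw [div_mul_eq_mul_div, div_le_iff₀ (by positivity)]; nlinarith
  change _ ≤ gaugeR U ((p : ℝ) • c) * T + ε
  nlinarith

lemma s17_quad {n d : ℕ} (Y : Matrix (Fin n) (Fin d) ℝ) (u : Fin n → ℝ) :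
    u ⬝ᵥ (Y * Yᵀ).mulVec u = (Yᵀ.mulVec u) ⬝ᵥ (Yᵀ.mulVec u) := by
  rw [← mulVec_mulVec, dotProduct_mulVec, ← mulVec_transpose]

lemma s17_upper {n d : ℕ} {U : Set (Fin n → ℝ)} (hU : IsCompact U)
    (h0 : U.Nonempty) (Y : Matrix (Fin n) (Fin d) ℝ) (w : Fin n → ℝ) :
    ((gaugeR U w)⁻¹ • w) ⬝ᵥ (Y * Yᵀ).mulVec ((gaugeR U w)⁻¹ • w) ≤ (ThetaPolarL2 U Y) ^ 2 := by
  have hT := s17_polar_nonneg hU h0 Y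
  have hg0 : 0 ≤ gaugeR U w := ENNReal.toReal_nonneg
  rcases hg0.eq_or_lt with hg | hg
  · rw [← hg]; simp; positivity
  have hw : gaugeE U w ≠ ⊤ := by
    intro h; simp [gaugeR, h] at hg
  rw [s17_quad]
  set g := gaugeR U w
  set z := Yᵀ.mulVec w with hz
  have e1 : Yᵀ.mulVec (g⁻¹ • w) = g⁻¹ • z := by rw [mulVec_smul]
  rw [e1]
  have e2 : (g⁻¹ • z) ⬝ᵥ (g⁻¹ • z) = (z ⬝ᵥ z) / g ^ 2 := by
    simp; field_simp
  rw [e2, div_le_iff₀ (by positivity)]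
  rcases eq_or_ne z 0 with h | h
  · rw [h]; simp; positivity
  have hz0 := s17_dot_pos h
  set q := Real.sqrt (z ⬝ᵥ z) with hq
  have hq0 : 0 < q := Real.sqrt_pos.2 hz0
  have hqq : q ^ 2 = z ⬝ᵥ z := Real.sq_sqrt hz0.le
  have h1 := s17_le_gauge hU h0 Y (q⁻¹ • z) (by simp [← hqq]; field_simp; rfl) w hw
  have h2 : w ⬝ᵥ Y.mulVec (q⁻¹ • z) = q := by
    rw [dotProduct_mulVec, ← mulVec_transpose, ← hz]
    simp [← hqq]; field_simp
  rw [h2] at h1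
  rw [← hqq, ← mul_pow]
  rw [mul_comm]
  gcongr

/-- The closed convex hull contains a Euclidean ball. -/
lemma s17_ball {n : ℕ} {U : Set (Fin n → ℝ)} (hp : IsCompact (vpolar U)) :
    ∃ δ : ℝ, 0 < δ ∧ ∀ u : Fin n → ℝ, u ⬝ᵥ u ≤ δ ^ 2 → u ∈ cvx U := by
  obtain ⟨B, hB0, hB⟩ := s17_bdd hp
  refine ⟨B⁻¹, by positivity, fun u hu => ?_⟩
  by_contra hcon
  have hcv : Convex ℝ (cvx U) := (convex_convexHull ℝ _).closure
  have hcl : IsClosed (cvx U) := isClosed_closure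
  obtain ⟨f, s, h1, h2⟩ := geometric_hahn_banach_closed_point hcv hcl hcon
  have hsub : insert 0 U ⊆ cvx U := (subset_convexHull ℝ _).trans subset_closure
  have hs : 0 < s := by simpa using h1 0 (hsub (by simp))
  set y : Fin n → ℝ := fun i => s⁻¹ * f (Pi.single i 1) with hy
  have hf : ∀ x, x ⬝ᵥ y = s⁻¹ * f x := by
    intro x
    conv_rhs => rw [← Finset.univ_sum_single x]
    rw [map_sum, Finset.mul_sum]
    simp only [dotProduct, hy]
    refine Finset.sum_congr rfl fun i _ => ?_
    have : (Pi.single i (x i) : Fin n → ℝ) = x i • Pi.single i 1 := by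
      rw [← Pi.single_smul]; simp
    rw [this, map_smul]; simp; ring
  have hyp : y ∈ vpolar U := by
    intro x hx
    rw [hf, inv_mul_le_iff₀ hs]
    simpa using (h1 x (hsub (by simp [hx]))).le
  have h3 := hB y hyp
  have h4 : 1 < u ⬝ᵥ y := by
    rw [hf, lt_inv_mul_iff₀ hs]; simpa using h2
  have h5 := s17_cs u y
  have h6 : (u ⬝ᵥ u) * (y ⬝ᵥ y) ≤ (B⁻¹) ^ 2 * B ^ 2 := by
    gcongr
    exact s17_dot_nonneg _
  have h7 : (B⁻¹) ^ 2 * B ^ 2 = 1 := by field_simp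
  nlinarith

lemma s17_gauge_le {n : ℕ} {U : Set (Fin n → ℝ)} {x : Fin n → ℝ} {p : ℝ} (hp : 0 ≤ p)
    (h : x ∈ p • cvx U) : gaugeE U x ≤ ENNReal.ofReal p := by
  unfold gaugeE
  exact iInf₂_le (⟨p, hp⟩ : ℝ≥0) h |>.trans (by rw [ENNReal.ofReal_eq_coe_nnreal hp]; exact le_rfl)

lemma s17_gauge_smul_le {n : ℕ} {U : Set (Fin n → ℝ)} (x : Fin n → ℝ) (c : ℝ) (hc : 0 < c) :
    gaugeE U (c • x) ≤ ENNReal.ofReal c * gaugeE U x := by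
  conv_rhs => unfold gaugeE
  rw [ENNReal.mul_iInf_of_ne (by simpa using hc) (by simp)]
  refine le_iInf fun p => ?_
  rw [ENNReal.mul_iInf_of_ne (by simpa using hc) (by simp)]
  refine le_iInf fun hp => ?_
  have := s17_gauge_le (U := U) (x := c • x) (p := c * p) (by positivity)
    (by rw [mul_smul]; exact smul_mem_smul_set hp)
  rw [ENNReal.ofReal_mul hc.le] at this
  simpa using this

lemma s17_cvx_bdd {n : ℕ} {U : Set (Fin n → ℝ)} (hU : IsCompact U) :
    ∃ B : ℝ, 0 < B ∧ ∀ u ∈ cvx U, u ⬝ᵥ u ≤ B ^ 2 := by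
  have hb : Bornology.IsBounded (cvx U) := by
    unfold cvx
    refine Bornology.IsBounded.closure ?_
    rw [isBounded_convexHull]
    exact hU.isBounded.insert 0
  exact s17_bdd (Metric.isCompact_of_isClosed_isBounded isClosed_closure hb)

lemma s17_gauge_pos {n : ℕ} {U : Set (Fin n → ℝ)} (hU : IsCompact U) {w : Fin n → ℝ}
    (hw : w ≠ 0) : gaugeE U w ≠ 0 := by
  obtain ⟨B, hB0, hB⟩ := s17_cvx_bdd hU
  have hpos := s17_dot_pos hw
  have : ENNReal.ofReal (Real.sqrt (w ⬝ᵥ w) / B) ≤ gaugeE U w := by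
    unfold gaugeE
    refine le_iInf₂ fun p hp => ?_
    obtain ⟨c, hc, rfl⟩ := hp
    rw [ENNReal.ofReal_le_iff_le_toReal (by simp)]
    simp only [ENNReal.coe_toReal]
    rw [div_le_iff₀ hB0]
    refine Real.sqrt_le_iff.2 ⟨by positivity, ?_⟩
    have : ((p : ℝ) • c) ⬝ᵥ ((p : ℝ) • c) = (p : ℝ) ^ 2 * (c ⬝ᵥ c) := by simp; ring
    show ((p : ℝ) • c) ⬝ᵥ ((p : ℝ) • c) ≤ _
    rw [this, mul_pow]
    gcongr
    exact hB c hc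
  intro h
  rw [h] at this
  have h2 : 0 < Real.sqrt (w ⬝ᵥ w) / B := by positivity
  simp at this
  linarith

/-- `G = max_{‖u‖≤1} γ(u)` bounds the gauge. -/
lemma s17_gauge_bound {n : ℕ} {U : Set (Fin n → ℝ)} (hp : IsCompact (vpolar U))
    (w : Fin n → ℝ) : gaugeE U w ≠ ⊤ ∧ (gaugeR U w) ≤
      sSup {t : ℝ | ∃ u : Fin n → ℝ, u ⬝ᵥ u ≤ 1 ∧ t = gaugeR U u} * Real.sqrt (w ⬝ᵥ w) := by
  obtain ⟨δ, hδ, hball⟩ := s17_ball hp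
  have hunit : ∀ u : Fin n → ℝ, u ⬝ᵥ u ≤ 1 → gaugeE U u ≤ ENNReal.ofReal δ⁻¹ := by
    intro u hu
    refine s17_gauge_le (by positivity) ?_
    refine ⟨δ • u, hball _ ?_, ?_⟩
    · simp; nlinarith [mul_pos hδ hδ]
    · simp [smul_smul, hδ.ne']
  have hbdd : BddAbove {t : ℝ | ∃ u : Fin n → ℝ, u ⬝ᵥ u ≤ 1 ∧ t = gaugeR U u} := by
    refine ⟨δ⁻¹, ?_⟩
    rintro t ⟨u, hu, rfl⟩
    exact ENNReal.toReal_le_of_le_ofReal (by positivity) (hunit u hu)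
  rcases eq_or_ne w 0 with rfl | hw
  · have h0 : gaugeE U (0 : Fin n → ℝ) = 0 := by
      have := s17_gauge_le (U := U) (x := 0) (p := 0) le_rfl
        ⟨0, subset_closure (subset_convexHull ℝ _ (by simp)), by simp⟩
      simpa using this
    simp [h0, gaugeR]
  have hpos := s17_dot_pos hw
  set q := Real.sqrt (w ⬝ᵥ w) with hq
  have hq0 : 0 < q := Real.sqrt_pos.2 hpos
  have hqq : q ^ 2 = w ⬝ᵥ w := Real.sq_sqrt hpos.le
  have hx : (q⁻¹ • w) ⬝ᵥ (q⁻¹ • w) ≤ 1 := by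
    simp [← hqq]; field_simp; rfl
  have h1 := s17_gauge_smul_le (U := U) (q⁻¹ • w) q hq0
  rw [smul_smul, mul_inv_cancel₀ hq0.ne', one_smul] at h1
  have hfin : gaugeE U (q⁻¹ • w) ≠ ⊤ := ne_top_of_le_ne_top (by simp) (hunit _ hx)
  refine ⟨ne_top_of_le_ne_top (ENNReal.mul_ne_top (by simp) hfin) h1, ?_⟩
  have h2 := ENNReal.toReal_mono (ENNReal.mul_ne_top (by simp) hfin) h1
  rw [ENNReal.toReal_mul, ENNReal.toReal_ofReal hq0.le] at h2
  have h3 : gaugeR U (q⁻¹ • w) ≤ _ := le_csSup hbdd ⟨_, hx, rfl⟩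
  unfold gaugeR at *
  nlinarith

/-- `R = max_{Θ(Z) ≤ 1} ‖Z‖_F` bounds `‖u‖` on `U`. -/
lemma s17_R_bound {n d : ℕ} (hd : 0 < d) {U : Set (Fin n → ℝ)} (hU : IsCompact U)
    (u : Fin n → ℝ) (hu : u ∈ U) :
    Real.sqrt (u ⬝ᵥ u) ≤ sSup {t : ℝ | ∃ Z : Matrix (Fin n) (Fin d) ℝ, ThetaL2 U Z ≤ 1 ∧
      t = Real.sqrt ((Zᵀ * Z).trace)} := by
  obtain ⟨B, hB0, hB⟩ := s17_bdd hU
  have htr : ∀ Z : Matrix (Fin n) (Fin d) ℝ, (Zᵀ * Z).trace = ∑ j, ∑ i, Z i j ^ 2 := by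
    intro Z
    simp [Matrix.trace, Matrix.mul_apply, pow_two]
  refine le_csSup ?_ ?_
  · refine ⟨Real.sqrt (∑ _j : Fin d, ∑ _i : Fin n, (2 * B) ^ 2), ?_⟩
    rintro t ⟨Z, hZ, rfl⟩
    apply Real.sqrt_le_sqrt
    rw [htr]
    refine Finset.sum_le_sum fun j _ => Finset.sum_le_sum fun i _ => ?_
    have hlt : ThetaL2 U Z < 2 := hZ.trans_lt (by norm_num)
    unfold ThetaL2 at hlt
    obtain ⟨t, ⟨k, lam, a, b, hl, ha, hb, rfl, rfl⟩, ht⟩ := sInf_lt_iff.1 hlt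
    have hs : ∑ m, lam m < 2 := by
      have := (ENNReal.ofReal_lt_iff_lt_toReal (Finset.sum_nonneg fun m _ => hl m) (by simp)).1 ht
      simpa using this
    have hab : ∀ m, |a m i * b m j| ≤ B := by
      intro m
      have h1 : a m i ^ 2 ≤ B ^ 2 := by
        refine le_trans ?_ (hB _ (ha m))
        simp only [dotProduct]
        rw [pow_two]
        exact Finset.single_le_sum (f := fun i => a m i * a m i)
          (fun i _ => mul_self_nonneg _) (Finset.mem_univ i)
      have h2 : b m j ^ 2 ≤ 1 := by
        refine le_trans ?_ (hb m)
        simp only [dotProduct]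
        rw [pow_two]
        exact Finset.single_le_sum (f := fun i => b m i * b m i)
          (fun i _ => mul_self_nonneg _) (Finset.mem_univ j)
      apply abs_le_of_sq_le_sq _ hB0.le
      rw [mul_pow]
      nlinarith [sq_nonneg (a m i), sq_nonneg (b m j)]
    have h3 : |(∑ m, lam m • vecMulVec (a m) (b m)) i j| ≤ 2 * B := by
      simp only [Matrix.sum_apply, Matrix.smul_apply, vecMulVec_apply, smul_eq_mul]
      refine (Finset.abs_sum_le_sum_abs _ _).trans ?_
      calc ∑ m, |lam m * (a m i * b m j)| ≤ ∑ m, lam m * B := by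
            refine Finset.sum_le_sum fun m _ => ?_
            rw [abs_mul, abs_of_nonneg (hl m)]
            exact mul_le_mul_of_nonneg_left (hab m) (hl m)
        _ = (∑ m, lam m) * B := by rw [Finset.sum_mul]
        _ ≤ 2 * B := by gcongr
    exact sq_le_sq' (by linarith [abs_le.1 h3]) (abs_le.1 h3).2
  · refine ⟨vecMulVec u (Pi.single ⟨0, hd⟩ 1), ?_, ?_⟩
    · refine sInf_le ⟨1, fun _ => 1, fun _ => u, fun _ => Pi.single ⟨0, hd⟩ 1, ?_, ?_, ?_, ?_, ?_⟩
      · intro; norm_num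
      · intro; exact hu
      · intro; simp
      · simp
      · simp
    · congr 1
      rw [htr, Finset.sum_eq_single ⟨0, hd⟩]
      · simp [vecMulVec_apply, dotProduct, pow_two]
      · intro b _ hb
        simp [vecMulVec_apply, hb]
      · simp

lemma s17_lower {n d r : ℕ} {U : Set (Fin n → ℝ)} (hU : IsCompact U)
    (hp : IsCompact (vpolar U)) (h0 : U.Nonempty) (w : Fin r → Fin n → ℝ)
    (hw : ∀ x : Fin n → ℝ, x ≠ 0 → ∃ i, (w i ⬝ᵥ w i) * (x ⬝ᵥ x) < 16 * n * (x ⬝ᵥ w i) ^ 2)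
    (Y : Matrix (Fin n) (Fin d) ℝ) :
    (1 / (kappa17 (d := d) U) ^ 2) * (ThetaPolarL2 U Y) ^ 2 ≤
            ⨆ i : Fin r, ((gaugeR U (w i))⁻¹ • w i) ⬝ᵥ
              (Y * Yᵀ).mulVec ((gaugeR U (w i))⁻¹ • w i) := by
  have hT := s17_polar_nonneg hU h0 Y
  set S := ⨆ i : Fin r, ((gaugeR U (w i))⁻¹ • w i) ⬝ᵥ
              (Y * Yᵀ).mulVec ((gaugeR U (w i))⁻¹ • w i) with hS
  have hS0 : 0 ≤ S := by
    refine Real.iSup_nonneg fun i => ?_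
    rw [s17_quad]; exact s17_dot_nonneg _
  set K := kappa17 (d := d) U with hK
  suffices h : (ThetaPolarL2 U Y) ^ 2 ≤ K ^ 2 * S by
    rcases eq_or_ne K 0 with hk | hk
    · simp [hk, hS0]
    · rw [one_div, inv_mul_le_iff₀ (by positivity)]; exact h
  set G := sSup {t : ℝ | ∃ u : Fin n → ℝ, u ⬝ᵥ u ≤ 1 ∧ t = gaugeR U u} with hG
  set R := sSup {t : ℝ | ∃ Z : Matrix (Fin n) (Fin d) ℝ, ThetaL2 U Z ≤ 1 ∧
      t = Real.sqrt ((Zᵀ * Z).trace)} with hR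
  have hK2 : K ^ 2 = 16 * n * R ^ 2 * G ^ 2 := by
    have : K = 4 * Real.sqrt n * R * G := rfl
    rw [this, mul_pow, mul_pow, mul_pow, Real.sq_sqrt (by positivity)]; norm_num
  have hG0 : 0 ≤ G := Real.sSup_nonneg (by rintro t ⟨u, _, rfl⟩; exact ENNReal.toReal_nonneg)
  have key : ThetaPolarL2 U Y ≤ Real.sqrt (K ^ 2 * S) := by
    refine csSup_le ?_ ?_
    · obtain ⟨u, hu⟩ := h0
      exact ⟨_, u, hu, 0, by simp, rfl⟩
    rintro t ⟨u, hu, v, hv, rfl⟩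
    rcases Nat.eq_zero_or_pos d with rfl | hd
    · have : Y.mulVec v = 0 := by ext i; simp [mulVec, dotProduct]
      rw [this]; simp
    apply Real.le_sqrt_of_sq_le
    set x := Y.mulVec v with hx
    rcases eq_or_ne x 0 with h | h
    · rw [h]; simp; positivity
    obtain ⟨i, hi⟩ := hw x h
    have hx0 := s17_dot_pos h
    have hwi : w i ≠ 0 := by
      intro hcon; rw [hcon] at hi; simp at hi
    have hwi0 := s17_dot_pos hwi
    obtain ⟨hfin, hgb⟩ := s17_gauge_bound hp (w i)
    have hgpos : 0 < gaugeR U (w i) := ENNReal.toReal_pos (s17_gauge_pos hU hwi) hfin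
    have hRu := s17_R_bound (d := d) hd hU u hu
    rw [← hR] at hRu
    rw [← hG] at hgb
    have hSi : (Yᵀ.mulVec (w i) ⬝ᵥ Yᵀ.mulVec (w i)) ≤ S * gaugeR U (w i) ^ 2 := by
      have h1 : ((gaugeR U (w i))⁻¹ • w i) ⬝ᵥ
              (Y * Yᵀ).mulVec ((gaugeR U (w i))⁻¹ • w i) ≤ S :=
        le_ciSup (f := fun i => ((gaugeR U (w i))⁻¹ • w i) ⬝ᵥ
              (Y * Yᵀ).mulVec ((gaugeR U (w i))⁻¹ • w i)) (Set.finite_range _).bddAbove i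
      rw [s17_quad, mulVec_smul] at h1
      simp only [smul_dotProduct, dotProduct_smul, smul_eq_mul] at h1
      rw [← mul_assoc, ← mul_inv, inv_mul_le_iff₀ (by positivity)] at h1
      nlinarith
    have hcs : (x ⬝ᵥ w i) ^ 2 ≤ (Yᵀ.mulVec (w i) ⬝ᵥ Yᵀ.mulVec (w i)) := by
      have e : x ⬝ᵥ w i = (Yᵀ.mulVec (w i)) ⬝ᵥ v := by
        rw [dotProduct_comm, hx, dotProduct_mulVec, mulVec_transpose]
      rw [e]
      have h1 := s17_cs (Yᵀ.mulVec (w i)) v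
      have h2 := s17_dot_nonneg (Yᵀ.mulVec (w i))
      nlinarith
    have hg2 : gaugeR U (w i) ^ 2 ≤ G ^ 2 * (w i ⬝ᵥ w i) := by
      calc gaugeR U (w i) ^ 2 ≤ (G * Real.sqrt (w i ⬝ᵥ w i)) ^ 2 := by gcongr
        _ = _ := by rw [mul_pow, Real.sq_sqrt hwi0.le]
    have hx2 : x ⬝ᵥ x ≤ 16 * n * (S * G ^ 2) := by
      have h1 : (w i ⬝ᵥ w i) * (x ⬝ᵥ x) ≤ (w i ⬝ᵥ w i) * (16 * n * (S * G ^ 2)) := by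
        calc (w i ⬝ᵥ w i) * (x ⬝ᵥ x) ≤ 16 * n * (x ⬝ᵥ w i) ^ 2 := hi.le
          _ ≤ 16 * n * (S * (G ^ 2 * (w i ⬝ᵥ w i))) := by
              gcongr
              exact (hcs.trans hSi).trans (by gcongr)
          _ = _ := by ring
      exact le_of_mul_le_mul_left h1 hwi0
    have hu2 : u ⬝ᵥ u ≤ R ^ 2 := by
      have := Real.sqrt_le_iff.1 hRu
      exact this.2
    calc (u ⬝ᵥ x) ^ 2 ≤ (u ⬝ᵥ u) * (x ⬝ᵥ x) := s17_cs u x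
      _ ≤ R ^ 2 * (16 * n * (S * G ^ 2)) := by gcongr
      _ = K ^ 2 * S := by rw [hK2]; ring
  calc (ThetaPolarL2 U Y) ^ 2 ≤ (Real.sqrt (K ^ 2 * S)) ^ 2 := by gcongr
    _ = _ := Real.sq_sqrt (by positivity)

/-! ### Gaussian tools -/

lemma s17_gauss_ratio (m1 m2 : ℝ) {v1 v2 : ℝ≥0} (h1 : v1 ≠ 0) (h2 : v2 ≠ 0) :
    gaussianReal m1 v1 = (gaussianReal m2 v2).withDensity (fun x => ENNReal.ofReal
      (Real.sqrt (v2 / v1) *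
        Real.exp (-(x - m1) ^ 2 / (2 * v1) + (x - m2) ^ 2 / (2 * v2)))) := by
  rw [gaussianReal_of_var_ne_zero m1 h1, gaussianReal_of_var_ne_zero m2 h2,
    ← withDensity_mul _ (by fun_prop) (by fun_prop)]
  congr 1
  ext x
  simp only [Pi.mul_apply, gaussianPDF]
  rw [← ENNReal.ofReal_mul (gaussianPDFReal_nonneg _ _ _)]
  congr 1
  simp only [gaussianPDFReal]
  have p1 : (0 : ℝ) < v1 := by positivity
  have p2 : (0 : ℝ) < v2 := by positivity
  have e1 : Real.exp (-(x - m1) ^ 2 / (2 * v1)) = Real.exp (-(x - m2) ^ 2 / (2 * v2)) *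
      Real.exp (-(x - m1) ^ 2 / (2 * v1) + (x - m2) ^ 2 / (2 * v2)) := by
    rw [← Real.exp_add]; congr 1; ring
  have e2 : (Real.sqrt (2 * Real.pi * v1))⁻¹ = (Real.sqrt (2 * Real.pi * v2))⁻¹ *
      Real.sqrt (v2 / v1) := by
    rw [Real.sqrt_div p2.le, Real.sqrt_mul (by positivity) (v1 : ℝ),
      Real.sqrt_mul (by positivity) (v2 : ℝ)]
    have := Real.sqrt_pos.2 p1
    have := Real.sqrt_pos.2 p2
    field_simp
  rw [e1, e2]; ring

lemma s17_lintegral_pi_prod {ι : Type*} [Fintype ι] {E : ι → Type*}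
    [∀ i, MeasurableSpace (E i)] (μ : ∀ i, Measure (E i)) [∀ i, IsProbabilityMeasure (μ i)]
    (f : ∀ i, E i → ℝ≥0∞) (hf : ∀ i, Measurable (f i)) :
    ∫⁻ x, ∏ i, f i (x i) ∂Measure.pi μ = ∏ i, ∫⁻ x, f i x ∂μ i := by
  have hind := iIndepFun_pi (μ := μ) (X := f) (fun i => (hf i).aemeasurable)
  rw [lintegral_prod_eq_prod_lintegral_of_indepFun Finset.univ
    (fun i (ω : ∀ i, E i) => f i (ω i)) hind (fun i => (hf i).comp (measurable_pi_apply i))]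
  refine Finset.prod_congr rfl fun i _ => ?_
  exact (measurePreserving_eval μ i).lintegral_comp (hf i)

lemma s17_pi_withDensity {ι : Type*} [Fintype ι] {E : ι → Type*}
    [∀ i, MeasurableSpace (E i)] (μ ν : ∀ i, Measure (E i)) [∀ i, IsProbabilityMeasure (μ i)]
    [∀ i, IsProbabilityMeasure (ν i)]
    (f : ∀ i, E i → ℝ≥0∞) (hf : ∀ i, Measurable (f i))
    (h : ∀ i, ν i = (μ i).withDensity (f i)) :
    Measure.pi ν = (Measure.pi μ).withDensity (fun x => ∏ i, f i (x i)) := by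
  classical
  refine Measure.pi_eq fun s hs => ?_
  rw [withDensity_apply _ (MeasurableSet.univ_pi hs),
    ← lintegral_indicator (MeasurableSet.univ_pi hs)]
  have : ∀ x, (Set.pi univ s).indicator (fun x => ∏ i, f i (x i)) x =
      ∏ i, (s i).indicator (f i) (x i) := by
    intro x
    by_cases hx : x ∈ Set.pi univ s
    · rw [indicator_of_mem hx]
      refine Finset.prod_congr rfl fun i _ => ?_
      rw [indicator_of_mem (hx i (mem_univ i))]
    · rw [indicator_of_notMem hx]
      simp only [Set.mem_pi, mem_univ, true_implies, not_forall] at hx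
      obtain ⟨i, hi⟩ := hx
      exact (Finset.prod_eq_zero (Finset.mem_univ i) (indicator_of_notMem hi _)).symm
  simp_rw [this]
  rw [s17_lintegral_pi_prod μ _ (fun i => (hf i).indicator (hs i))]
  refine Finset.prod_congr rfl fun i _ => ?_
  rw [lintegral_indicator (hs i), h i, withDensity_apply _ (hs i)]

lemma s17_pi_ratio {n : ℕ} (m1 m2 : Fin n → ℝ) {v1 v2 : ℝ≥0} (h1 : v1 ≠ 0) (h2 : v2 ≠ 0)
    (F : (Fin n → ℝ) → ℝ≥0∞) (hF : Measurable F) :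
    ∫⁻ y, F y ∂(Measure.pi fun j => gaussianReal (m1 j) v1) =
    ∫⁻ y, ENNReal.ofReal (Real.sqrt (v2 / v1) ^ n * Real.exp
      (∑ j, (-(y j - m1 j) ^ 2 / (2 * v1) + (y j - m2 j) ^ 2 / (2 * v2)))) * F y
      ∂(Measure.pi fun j => gaussianReal (m2 j) v2) := by
  rw [s17_pi_withDensity (fun j => gaussianReal (m2 j) v2) (fun j => gaussianReal (m1 j) v1)
    _ ?_ (fun j => s17_gauss_ratio (m1 j) (m2 j) h1 h2)]
  rotate_left
  · intro i; fun_prop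
  rw [lintegral_withDensity_eq_lintegral_mul _ (by fun_prop) hF]
  refine lintegral_congr fun y => ?_
  simp only [Pi.mul_apply]
  rw [← ENNReal.ofReal_prod_of_nonneg (fun i _ => by positivity), Finset.prod_mul_distrib,
    Finset.prod_const, Real.exp_sum]
  simp

lemma s17_law {n : ℕ} (a m : Fin n → ℝ) (v : ℝ≥0) :
    (Measure.pi fun j => gaussianReal (m j) v).map (fun y => a ⬝ᵥ y) =
      gaussianReal (a ⬝ᵥ m) (v * (a ⬝ᵥ a).toNNReal) := by
  have hm : Measurable fun y : Fin n → ℝ => a ⬝ᵥ y := by unfold dotProduct; fun_prop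
  have : IsProbabilityMeasure ((Measure.pi fun j => gaussianReal (m j) v).map
      (fun y => a ⬝ᵥ y)) := Measure.isProbabilityMeasure_map hm.aemeasurable
  refine Measure.ext_of_charFun ?_
  ext t
  rw [charFun_gaussianReal, charFun_apply_real, integral_map hm.aemeasurable (by fun_prop)]
  have e : ∀ y : Fin n → ℝ, Complex.exp (t * ((a ⬝ᵥ y : ℝ) : ℂ) * Complex.I) =
      ∏ j, Complex.exp (((t * a j : ℝ) : ℂ) * (y j : ℂ) * Complex.I) := by
    intro y
    rw [← Complex.exp_sum]
    congr 1
    simp only [dotProduct]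
    push_cast
    rw [Finset.mul_sum, Finset.sum_mul]
    refine Finset.sum_congr rfl fun j _ => by ring
  simp_rw [e]
  rw [integral_fintype_prod_eq_prod (μ := fun j => gaussianReal (m j) v)
    (f := fun j (z : ℝ) => Complex.exp (((t * a j : ℝ) : ℂ) * (z : ℂ) * Complex.I))]
  simp_rw [← charFun_apply_real, charFun_gaussianReal]
  rw [← Complex.exp_sum]
  congr 1
  have e2 : (((v * (a ⬝ᵥ a).toNNReal : ℝ≥0) : ℝ) : ℂ) = ((v * (a ⬝ᵥ a) : ℝ) : ℂ) := by
    congr 1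
    rw [NNReal.coe_mul, Real.coe_toNNReal _ (s17_dot_nonneg a)]
  rw [e2]
  simp only [dotProduct]
  push_cast
  rw [Finset.sum_sub_distrib, Finset.mul_sum, Finset.sum_mul, Finset.mul_sum, Finset.sum_mul,
    Finset.sum_div]
  congr 1 <;> exact Finset.sum_congr rfl fun j _ => by ring

lemma s17_moments {n : ℕ} (a m : Fin n → ℝ) (v : ℝ≥0) :
    Integrable (fun y => a ⬝ᵥ y) (Measure.pi fun j => gaussianReal (m j) v) ∧
    Integrable (fun y => (a ⬝ᵥ y) ^ 2) (Measure.pi fun j => gaussianReal (m j) v) ∧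
    ∫ y, a ⬝ᵥ y ∂(Measure.pi fun j => gaussianReal (m j) v) = a ⬝ᵥ m ∧
    ∫ y, (a ⬝ᵥ y) ^ 2 ∂(Measure.pi fun j => gaussianReal (m j) v) =
      (a ⬝ᵥ m) ^ 2 + v * (a ⬝ᵥ a) := by
  have hm : Measurable fun y : Fin n → ℝ => a ⬝ᵥ y := by unfold dotProduct; fun_prop
  have hl := s17_law a m v
  have hL2 : MemLp id 2 (gaussianReal (a ⬝ᵥ m) (v * (a ⬝ᵥ a).toNNReal)) :=
    memLp_id_gaussianReal' 2 (by simp)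
  have i1 : Integrable (fun z : ℝ => z) (gaussianReal (a ⬝ᵥ m) (v * (a ⬝ᵥ a).toNNReal)) :=
    hL2.integrable (by norm_num)
  have i2 : Integrable (fun z : ℝ => z ^ 2) (gaussianReal (a ⬝ᵥ m) (v * (a ⬝ᵥ a).toNNReal)) :=
    hL2.integrable_sq
  have hvar := variance_fun_id_gaussianReal (μ := a ⬝ᵥ m) (v := v * (a ⬝ᵥ a).toNNReal)
  have hvar2 := variance_eq_sub hL2
  have hid : Var[id; gaussianReal (a ⬝ᵥ m) (v * (a ⬝ᵥ a).toNNReal)] =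
    v * (a ⬝ᵥ a) := by
    rw [variance_id_gaussianReal, NNReal.coe_mul, Real.coe_toNNReal _ (s17_dot_nonneg a)]
  refine ⟨?_, ?_, ?_, ?_⟩
  · rw [← hl] at i1
    exact i1.comp_measurable hm
  · rw [← hl] at i2
    exact i2.comp_measurable hm
  · have := integral_map (μ := Measure.pi fun j => gaussianReal (m j) v) hm.aemeasurable
      (f := fun z : ℝ => z) (by fun_prop)
    rw [← this, hl, integral_id_gaussianReal]
  · have := integral_map (μ := Measure.pi fun j => gaussianReal (m j) v) hm.aemeasurable
      (f := fun z : ℝ => z ^ 2) (by fun_prop)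
    rw [← this, hl]
    rw [hid] at hvar2
    have e : ∫ x, id x ∂(gaussianReal (a ⬝ᵥ m) (v * (a ⬝ᵥ a).toNNReal)) = a ⬝ᵥ m := by
      simp [integral_id_gaussianReal]
    rw [e] at hvar2
    simp only [Pi.pow_apply, id] at hvar2
    linarith

lemma s17_gauss_exp (V : ℝ≥0) :
    ENNReal.ofReal (Real.sqrt (1 + 4 * V)) *
      ∫⁻ t, ENNReal.ofReal (Real.exp (-2 * t ^ 2)) ∂gaussianReal 0 V = 1 := by
  rcases eq_or_ne V 0 with rfl | hV
  · simp [gaussianReal_zero_var]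
  have hV0 : (0 : ℝ) < V := by positivity
  have h1 : V / (1 + 4 * V) ≠ 0 := by positivity
  have h := s17_gauss_ratio 0 0 h1 hV
  have h2 : (1 : ℝ≥0∞) = gaussianReal 0 (V / (1 + 4 * V)) univ := by simp
  rw [h2, h, withDensity_apply _ MeasurableSet.univ, Measure.restrict_univ,
    ← lintegral_const_mul _ (by fun_prop)]
  refine lintegral_congr fun t => ?_
  rw [← ENNReal.ofReal_mul (by positivity)]
  congr 3
  · push_cast; field_simp
  · push_cast; field_simp; ring

/-- The Laplace-type transform used for the union bound. -/
lemma s17_laplace {n : ℕ} (y : Fin n → ℝ) (θ : ℝ) (hθ : 0 < 1 - 2 * θ) :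
    ENNReal.ofReal (Real.sqrt (1 - 2 * θ) ^ n * Real.sqrt (1 + 4 * ((y ⬝ᵥ y) / (1 - 2 * θ)))) *
    ∫⁻ w, ENNReal.ofReal (Real.exp (-2 * (y ⬝ᵥ w) ^ 2 + θ * (w ⬝ᵥ w)))
      ∂(Measure.pi fun _ : Fin n => gaussianReal 0 1) = 1 := by
  have hm : Measurable fun w : Fin n → ℝ => y ⬝ᵥ w := by unfold dotProduct; fun_prop
  have hm2 : Measurable fun w : Fin n → ℝ => w ⬝ᵥ w := by unfold dotProduct; fun_prop
  set T : ℝ≥0 := ⟨(1 - 2 * θ)⁻¹, by positivity⟩ with hT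
  have hTc : (T : ℝ) = (1 - 2 * θ)⁻¹ := rfl
  have hT0 : T ≠ 0 := by
    intro h
    have : (T : ℝ) = 0 := by rw [h]; rfl
    rw [hTc] at this
    have h3 : 0 < (1 - 2 * θ)⁻¹ := by positivity
    linarith
  have h1 := s17_pi_ratio (n := n) (fun _ => 0) (fun _ => 0) hT0 one_ne_zero
    (fun w => ENNReal.ofReal (Real.exp (-2 * (y ⬝ᵥ w) ^ 2))) (by fun_prop)
  have h2 := s17_gauss_exp (T * (y ⬝ᵥ y).toNNReal)
  have h3 := s17_law y (fun _ => 0) T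
  have h4 : y ⬝ᵥ (fun _ => (0 : ℝ)) = 0 := by simp [dotProduct]
  rw [h4] at h3
  rw [← h3, lintegral_map (by fun_prop) hm, h1] at h2
  rw [← h2, ENNReal.ofReal_mul (by positivity), mul_comm (ENNReal.ofReal (_ ^ n)), mul_assoc]
  congr 1
  · rw [NNReal.coe_mul, Real.coe_toNNReal _ (s17_dot_nonneg y), hTc]
    congr 4; field_simp
  · rw [← lintegral_const_mul _ (by fun_prop)]
    refine lintegral_congr fun w => ?_
    rw [← ENNReal.ofReal_mul (by positivity), ← ENNReal.ofReal_mul (by positivity), mul_assoc,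
      ← Real.exp_add]
    congr 3
    · rw [hTc]; simp
    · rw [add_comm]; congr 1
      simp only [dotProduct, Finset.mul_sum, hTc]
      refine Finset.sum_congr rfl fun j _ => ?_
      simp only [NNReal.coe_one]
      field_simp; ring

/-! ### The uniform small-ball estimate -/

lemma s17_log_poly (s : ℝ) :
    Real.log (91 / 20) / 2 + 80 / 91 * (s - 1) - 13 / 4 * (s - 1) ^ 2 ≤
      Real.log (11 / 20 + 4 * s ^ 2) / 2 := by
  set D := 11 / 20 + 4 * s ^ 2 with hD
  have hD0 : 0 < D := by positivity
  have h1 := Real.one_sub_inv_le_log_of_pos (x := D / (91 / 20)) (by positivity)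
  rw [Real.log_div hD0.ne' (by norm_num)] at h1
  have h2 : 2 * (80 / 91 * (s - 1) - 13 / 4 * (s - 1) ^ 2) ≤ 1 - (D / (91 / 20))⁻¹ := by
    rw [inv_div, le_sub_iff_add_le, ← le_sub_iff_add_le', div_le_iff₀ hD0, hD]
    nlinarith [mul_nonneg (sq_nonneg (s - 1)) (sq_nonneg (s - 160 / 1183)),
      mul_nonneg (sq_nonneg (s - 1)) (sq_nonneg s), sq_nonneg (s - 1)]
  linarith

lemma s17_numeric (N : ℝ) (hN : 1 ≤ N) :
    1 / 50 ≤ (N - 1) / 2 * Real.log (1 - 9 / 20 / N) + Real.log (91 / 20) / 2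
      - 13 / 4 * (1 / 20 / N) - Real.log 21 / 8 := by
  have hN0 : 0 < N := by linarith
  have he : 0 < 1 - 9 / 20 / N := by
    rw [sub_pos, div_lt_one hN0]; linarith
  have h1 := Real.one_sub_inv_le_log_of_pos he
  have h2 : 1 - (1 - 9 / 20 / N)⁻¹ = - (9 / 20) / (N - 9 / 20) := by
    have : N - 9 / 20 ≠ 0 := by linarith
    have h3 : 1 - 9 / 20 / N = (N - 9 / 20) / N := by field_simp
    rw [h3, inv_div, _root_.eq_div_iff this, sub_mul, div_mul_cancel₀ _ this]; ring
  rw [h2] at h1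
  have h3 : (N - 1) / 2 * (- (9 / 20) / (N - 9 / 20)) ≤
      (N - 1) / 2 * Real.log (1 - 9 / 20 / N) := by
    apply mul_le_mul_of_nonneg_left h1; linarith
  have h4 : -(1 / 4) ≤ (N - 1) / 2 * (- (9 / 20) / (N - 9 / 20)) - 13 / 4 * (1 / 20 / N) := by
    have hp : 0 < N - 9 / 20 := by linarith
    have e : (N - 1) / 2 * (- (9 / 20) / (N - 9 / 20)) - 13 / 4 * (1 / 20 / N) + 1 / 4 =
      (-(9 / 40) * (N - 1) * N - 13 / 80 * (N - 9 / 20) + 1 / 4 * (N * (N - 9 / 20))) /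
        ((N - 9 / 20) * N) := by
      rw [_root_.eq_div_iff (by positivity)]
      generalize hq : N - 9 / 20 = q at *
      obtain rfl : N = q + 9 / 20 := by linarith
      field_simp; ring
    have : 0 ≤ (-(9 / 40) * (N - 1) * N - 13 / 80 * (N - 9 / 20) + 1 / 4 * (N * (N - 9 / 20))) /
        ((N - 9 / 20) * N) := by
      apply div_nonneg
      · nlinarith
      · positivity
    linarith
  have h5 : (3 : ℝ) ≤ 4 * Real.log (91 / 20) - Real.log 21 := by
    have e : 4 * Real.log (91 / 20) - Real.log 21 = Real.log ((91 / 20) ^ 4 / 21) := by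
      rw [Real.log_div (x := (91 / 20) ^ 4) (by norm_num) (by norm_num), Real.log_pow]; norm_num
    rw [e, Real.le_log_iff_exp_le (by norm_num)]
    have h6 : Real.exp 3 = Real.exp 1 ^ 3 := by rw [← Real.exp_nat_mul]; norm_num
    rw [h6]
    calc Real.exp 1 ^ 3 ≤ 2.7183 ^ 3 := by
          gcongr
          exact Real.exp_one_lt_d9.le.trans (by norm_num)
      _ ≤ _ := by norm_num
  linarith

/-- Normalizing exponent. -/
def s17L (n : ℕ) (q : ℝ) : ℝ :=
  ((n : ℝ) - 1) / 2 * Real.log (1 - 9 / 20 / n) + Real.log (1 - 9 / 20 / n + 4 * q) / 2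

/-- The exponent of a single factor. -/
def s17f {n : ℕ} (y w : Fin n → ℝ) : ℝ :=
  -2 * (y ⬝ᵥ w) ^ 2 + 9 / 40 / n * (w ⬝ᵥ w) + s17L n (y ⬝ᵥ y)

lemma s17_e_ge {n : ℕ} (hn : 0 < n) : (11 : ℝ) / 20 ≤ 1 - 9 / 20 / n := by
  have : (1 : ℝ) ≤ n := by exact_mod_cast hn
  have h : 9 / 20 / (n : ℝ) ≤ 9 / 20 := div_le_self (by norm_num) this
  linarith

lemma s17_expL {n : ℕ} (hn : 0 < n) (q : ℝ) (hq : 0 ≤ q) :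
    Real.exp (s17L n q) = Real.sqrt (1 - 9 / 20 / n) ^ n *
      Real.sqrt (1 + 4 * (q / (1 - 9 / 20 / n))) := by
  have he := s17_e_ge hn
  set e : ℝ := 1 - 9 / 20 / n with hee
  have he0 : 0 < e := by linarith
  have h1 : ∀ z : ℝ, 0 < z → Real.sqrt z = Real.exp (Real.log z / 2) := by
    intro z hz
    rw [← Real.log_sqrt hz.le, Real.exp_log (Real.sqrt_pos.2 hz)]
  have h2 : 1 + 4 * (q / e) = (e + 4 * q) / e := by field_simp
  rw [h2, h1 e he0, h1 _ (by positivity), ← Real.exp_nat_mul, ← Real.exp_add,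
    Real.log_div (by positivity) he0.ne']
  congr 1
  unfold s17L
  rw [← hee]; ring

lemma s17_one_factor {n : ℕ} (hn : 0 < n) (y : Fin n → ℝ) :
    ∫⁻ w, ENNReal.ofReal (Real.exp (s17f y w))
      ∂(Measure.pi fun _ : Fin n => gaussianReal 0 1) = 1 := by
  have he := s17_e_ge hn
  have e1 : 1 - 2 * (9 / 40 / (n : ℝ)) = 1 - 9 / 20 / n := by ring
  have h := s17_laplace y (9 / 40 / n) (by rw [e1]; linarith)
  rw [e1, ← s17_expL hn _ (s17_dot_nonneg y)] at h
  have hm : Measurable fun w : Fin n → ℝ => y ⬝ᵥ w := by unfold dotProduct; fun_prop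
  have hm2 : Measurable fun w : Fin n → ℝ => w ⬝ᵥ w := by unfold dotProduct; fun_prop
  rw [← lintegral_const_mul _ (by fun_prop)] at h
  rw [← h]
  refine lintegral_congr fun w => ?_
  rw [← ENNReal.ofReal_mul (by positivity), ← Real.exp_add]
  congr 2
  unfold s17f; ring

lemma s17_meas_f {n : ℕ} {α : Type*} [MeasurableSpace α] {f g : α → Fin n → ℝ}
    (hf : Measurable f) (hg : Measurable g) : Measurable fun a => s17f (f a) (g a) := by
  unfold s17f s17L dotProduct
  fun_prop

/-- The mixture. -/
def s17H {n r : ℕ} (σ : ℝ≥0) (w : Fin r → Fin n → ℝ) : ℝ≥0∞ :=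
  ∫⁻ y, ∏ i, ENNReal.ofReal (Real.exp (s17f y (w i)))
    ∂(Measure.pi fun _ : Fin n => gaussianReal 0 σ)

lemma s17_meas_joint {n r : ℕ} : Measurable
    (fun p : (Fin r → Fin n → ℝ) × (Fin n → ℝ) =>
      ∏ i, ENNReal.ofReal (Real.exp (s17f p.2 (p.1 i)))) := by
  refine Finset.measurable_fun_prod _ fun i _ => ?_
  refine ENNReal.measurable_ofReal.comp (Real.measurable_exp.comp (s17_meas_f ?_ ?_)) <;> fun_prop

lemma s17_meas_H {n r : ℕ} (σ : ℝ≥0) : Measurable (s17H (n := n) (r := r) σ) := by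
  unfold s17H
  exact (s17_meas_joint (n := n) (r := r)).lintegral_prod_right'

lemma s17_mean_H {n r : ℕ} (hn : 0 < n) (σ : ℝ≥0) :
    ∫⁻ w, s17H (n := n) (r := r) σ w
      ∂(Measure.pi fun _ : Fin r => Measure.pi fun _ : Fin n => gaussianReal 0 1) = 1 := by
  unfold s17H
  rw [lintegral_lintegral_swap (s17_meas_joint (n := n) (r := r)).aemeasurable]
  have : ∀ y : Fin n → ℝ, ∫⁻ w : Fin r → Fin n → ℝ, ∏ i, ENNReal.ofReal (Real.exp (s17f y (w i)))
      ∂(Measure.pi fun _ : Fin r => Measure.pi fun _ : Fin n => gaussianReal 0 1) = 1 := by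
    intro y
    rw [s17_lintegral_pi_prod (fun _ : Fin r => Measure.pi fun _ : Fin n => gaussianReal 0 1)
      (fun _ w => ENNReal.ofReal (Real.exp (s17f y w)))]
    · simp [s17_one_factor hn]
    · intro i
      exact ENNReal.measurable_ofReal.comp
        (Real.measurable_exp.comp (s17_meas_f measurable_const measurable_id))
  simp [this]

/-- `f` is integrable with integral `c`. -/
def s17I {α : Type*} [MeasurableSpace α] (μ : Measure α) (f : α → ℝ) (c : ℝ) : Prop :=
  Integrable f μ ∧ ∫ a, f a ∂μ = c

lemma s17I.add {α : Type*} [MeasurableSpace α] {μ : Measure α} {f g : α → ℝ} {c d : ℝ}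
    (hf : s17I μ f c) (hg : s17I μ g d) : s17I μ (fun a => f a + g a) (c + d) :=
  ⟨hf.1.add hg.1, by rw [integral_add hf.1 hg.1, hf.2, hg.2]⟩

lemma s17I.sub {α : Type*} [MeasurableSpace α] {μ : Measure α} {f g : α → ℝ} {c d : ℝ}
    (hf : s17I μ f c) (hg : s17I μ g d) : s17I μ (fun a => f a - g a) (c - d) :=
  ⟨hf.1.sub hg.1, by rw [integral_sub hf.1 hg.1, hf.2, hg.2]⟩

lemma s17I.smul {α : Type*} [MeasurableSpace α] {μ : Measure α} {f : α → ℝ} {c : ℝ} (k : ℝ)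
    (hf : s17I μ f c) : s17I μ (fun a => k * f a) (k * c) :=
  ⟨hf.1.const_mul k, by rw [integral_const_mul, hf.2]⟩

lemma s17I.const {α : Type*} [MeasurableSpace α] {μ : Measure α} [IsProbabilityMeasure μ] (k : ℝ) :
    s17I μ (fun _ => k) k :=
  ⟨integrable_const k, by simp⟩

lemma s17I.sum {α ι : Type*} [MeasurableSpace α] {μ : Measure α} [Fintype ι] {f : ι → α → ℝ}
    {c : ι → ℝ} (hf : ∀ i, s17I μ (f i) (c i)) : s17I μ (fun a => ∑ i, f i a) (∑ i, c i) :=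
  ⟨integrable_finsetSum _ fun i _ => (hf i).1, by
    rw [integral_finsetSum _ fun i _ => (hf i).1]
    exact Finset.sum_congr rfl fun i _ => (hf i).2⟩

/-- Jensen's inequality for the exponential. -/
lemma s17_jensen {α : Type*} [MeasurableSpace α] {μ : Measure α} [IsProbabilityMeasure μ]
    {f : α → ℝ} {c t : ℝ} (hf : s17I μ f c) (ht : t ≤ c) :
    ENNReal.ofReal (Real.exp t) ≤ ∫⁻ a, ENNReal.ofReal (Real.exp (f a)) ∂μ := by
  have h1 : s17I μ (fun a => Real.exp t * (f a - (t - 1))) (Real.exp t * (c - (t - 1))) :=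
    (hf.sub (s17I.const _)).smul _
  calc ENNReal.ofReal (Real.exp t) ≤ ENNReal.ofReal (Real.exp t * (c - (t - 1))) := by
        apply ENNReal.ofReal_le_ofReal
        nlinarith [Real.exp_pos t]
    _ = ENNReal.ofReal (∫ a, Real.exp t * (f a - (t - 1)) ∂μ) := by rw [h1.2]
    _ ≤ ∫⁻ a, ENNReal.ofReal (Real.exp t * (f a - (t - 1))) ∂μ := by
        rw [integral_eq_lintegral_pos_part_sub_lintegral_neg_part h1.1]
        refine (ENNReal.ofReal_le_ofReal (sub_le_self _ ENNReal.toReal_nonneg)).trans ?_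
        exact ENNReal.ofReal_toReal_le
    _ ≤ _ := by
        refine lintegral_mono fun a => ENNReal.ofReal_le_ofReal ?_
        have h2 := Real.add_one_le_exp (f a - t)
        have h3 : Real.exp (f a) = Real.exp t * Real.exp (f a - t) := by
          rw [← Real.exp_add]; congr 1; ring
        rw [h3]
        apply mul_le_mul_of_nonneg_left _ (Real.exp_pos t).le
        linarith

/-- On the bad event the mixture is large. -/
lemma s17_H_large {n r : ℕ} (hn : 0 < n) (hr : 4 * n ≤ r) (w : Fin r → Fin n → ℝ)
    (x : Fin n → ℝ) (hx : x ⬝ᵥ x = 1)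
    (hw : ∀ i, 16 * n * (x ⬝ᵥ w i) ^ 2 ≤ w i ⬝ᵥ w i) :
    ENNReal.ofReal (Real.exp (r / 50)) ≤ s17H (21 / 20 / n) w := by
  have hn1 : (1 : ℝ) ≤ n := by exact_mod_cast hn
  have hn0 : (0 : ℝ) < n := by linarith
  have hnn : (n : ℝ≥0) ≠ 0 := by exact_mod_cast hn.ne'
  have hσ : (21 / 20 / n : ℝ≥0) ≠ 0 := by positivity
  have hδ : (1 / 20 / n : ℝ≥0) ≠ 0 := by positivity
  unfold s17H
  have hmF : Measurable fun y : Fin n → ℝ => ∏ i, ENNReal.ofReal (Real.exp (s17f y (w i))) := by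
    refine Finset.measurable_fun_prod _ fun i _ => ?_
    exact ENNReal.measurable_ofReal.comp
      (Real.measurable_exp.comp (s17_meas_f measurable_id measurable_const))
  rw [s17_pi_ratio (fun _ => 0) x hσ hδ _ hmF]
  set ν := Measure.pi fun j => gaussianReal (x j) (1 / 20 / n : ℝ≥0) with hν
  set c0 : ℝ := ((n : ℝ) - 1) / 2 * Real.log (1 - 9 / 20 / n) + Real.log (91 / 20) / 2 with hc0
  -- the quadratic minorant of the exponent
  set g : (Fin n → ℝ) → ℝ := fun y =>
    (∑ i, (-2 * (w i ⬝ᵥ y) ^ 2 + 9 / 40 / n * (w i ⬝ᵥ w i))) +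
    r * (c0 + (80 / 91 * (x ⬝ᵥ y - 1) - 13 / 4 * ((x ⬝ᵥ y) ^ 2 - 2 * (x ⬝ᵥ y) + 1)))
    - n / 2 * Real.log 21 +
    ∑ j, (-(n * (10 / 21)) * (Pi.single j 1 ⬝ᵥ y) ^ 2 + (n * 10) * ((Pi.single j 1 ⬝ᵥ y) ^ 2
      - 2 * x j * (Pi.single j 1 ⬝ᵥ y) + x j ^ 2)) with hg
  have hgle : ∀ y, Real.exp (g y) ≤
      (Real.sqrt (((1 / 20 / n : ℝ≥0) : ℝ) / ((21 / 20 / n : ℝ≥0) : ℝ)) ^ n * Real.exp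
      (∑ j, (-(y j - 0) ^ 2 / (2 * ((21 / 20 / n : ℝ≥0) : ℝ)) +
        (y j - x j) ^ 2 / (2 * ((1 / 20 / n : ℝ≥0) : ℝ))))) * ∏ i, Real.exp (s17f y (w i)) := by
    intro y
    have h1 : Real.sqrt (((1 / 20 / n : ℝ≥0) : ℝ) / ((21 / 20 / n : ℝ≥0) : ℝ)) ^ n =
        Real.exp (-(n / 2 * Real.log 21)) := by
      have e : ((1 / 20 / n : ℝ≥0) : ℝ) / ((21 / 20 / n : ℝ≥0) : ℝ) = (21 : ℝ)⁻¹ := by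
        push_cast; field_simp
      have h21 : Real.sqrt (21 : ℝ)⁻¹ = Real.exp (-(Real.log 21 / 2)) := by
        rw [Real.sqrt_inv, Real.exp_neg, ← Real.log_sqrt (by norm_num),
          Real.exp_log (by positivity)]
      rw [e, h21, ← Real.exp_nat_mul]
      congr 1; ring
    rw [h1, ← Real.exp_sum, ← Real.exp_add, ← Real.exp_add]
    apply Real.exp_le_exp.2
    have hs : (x ⬝ᵥ y) ^ 2 ≤ y ⬝ᵥ y := by
      have := s17_cs x y
      rwa [hx, one_mul] at this
    have hL : c0 + (80 / 91 * (x ⬝ᵥ y - 1) - 13 / 4 * ((x ⬝ᵥ y) ^ 2 - 2 * (x ⬝ᵥ y) + 1)) ≤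
        s17L n (y ⬝ᵥ y) := by
      have h2 := s17_log_poly (x ⬝ᵥ y)
      have h3 : Real.log (11 / 20 + 4 * (x ⬝ᵥ y) ^ 2) ≤
          Real.log (1 - 9 / 20 / n + 4 * (y ⬝ᵥ y)) := by
        apply Real.log_le_log (by positivity)
        have := s17_e_ge hn
        linarith
      have e : (x ⬝ᵥ y - 1) ^ 2 = (x ⬝ᵥ y) ^ 2 - 2 * (x ⬝ᵥ y) + 1 := by ring
      rw [e] at h2
      unfold s17L
      linarith
    have hL' := mul_le_mul_of_nonneg_left hL (Nat.cast_nonneg (α := ℝ) r)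
    have e2 : ∑ i, s17f y (w i) = (∑ i, (-2 * (w i ⬝ᵥ y) ^ 2 + 9 / 40 / n * (w i ⬝ᵥ w i))) +
        r * s17L n (y ⬝ᵥ y) := by
      simp only [s17f]
      rw [Finset.sum_add_distrib, Finset.sum_const]
      simp [dotProduct_comm]
    have e3 : ∑ j, (-(n * (10 / 21)) * (Pi.single j 1 ⬝ᵥ y) ^ 2 + (n * 10) *
        ((Pi.single j 1 ⬝ᵥ y) ^ 2 - 2 * x j * (Pi.single j 1 ⬝ᵥ y) + x j ^ 2)) =
        (∑ j, (-(y j - 0) ^ 2 / (2 * ((21 / 20 / n : ℝ≥0) : ℝ)) +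
        (y j - x j) ^ 2 / (2 * ((1 / 20 / n : ℝ≥0) : ℝ)))) := by
      refine Finset.sum_congr rfl fun j _ => ?_
      rw [single_one_dotProduct]
      push_cast
      field_simp
      ring
    simp only [hg]
    rw [e2, e3]
    linarith
  have hI := fun a : Fin n → ℝ => s17_moments a x (1 / 20 / n : ℝ≥0)
  rw [← hν] at hI
  have I1 : ∀ a : Fin n → ℝ, s17I ν (fun y => a ⬝ᵥ y) (a ⬝ᵥ x) :=
    fun a => ⟨(hI a).1, (hI a).2.2.1⟩
  have I2 : ∀ a : Fin n → ℝ, s17I ν (fun y => (a ⬝ᵥ y) ^ 2)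
      ((a ⬝ᵥ x) ^ 2 + 1 / 20 / n * (a ⬝ᵥ a)) := by
    intro a
    refine ⟨(hI a).2.1, ?_⟩
    rw [(hI a).2.2.2]; push_cast; rfl
  have hgI : s17I ν g _ :=
    ((((s17I.sum fun i => ((I2 (w i)).smul (-2)).add (s17I.const (9 / 40 / n * (w i ⬝ᵥ w i)))).add
      (((s17I.const c0).add ((((I1 x).sub (s17I.const 1)).smul (80 / 91)).sub
        (((((I2 x).sub ((I1 x).smul 2)).add (s17I.const 1))).smul (13 / 4)))).smul r)).sub
      (s17I.const (n / 2 * Real.log 21))).add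
      (s17I.sum fun j => ((I2 (Pi.single j 1)).smul (-(n * (10 / 21)))).add
        ((((I2 (Pi.single j 1)).sub ((I1 (Pi.single j 1)).smul (2 * x j))).add
          (s17I.const (x j ^ 2))).smul (n * 10))))
  refine (s17_jensen hgI ?_).trans ?_
  · have t1 : 0 ≤ ∑ i, (-2 * ((w i ⬝ᵥ x) ^ 2 + 1 / 20 / n * (w i ⬝ᵥ w i)) +
        9 / 40 / n * (w i ⬝ᵥ w i)) := by
      refine Finset.sum_nonneg fun i _ => ?_
      have h := hw i
      rw [dotProduct_comm x] at h
      have e : -2 * ((w i ⬝ᵥ x) ^ 2 + 1 / 20 / n * (w i ⬝ᵥ w i)) +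
        9 / 40 / n * (w i ⬝ᵥ w i) = (w i ⬝ᵥ w i - 16 * n * (w i ⬝ᵥ x) ^ 2) / (8 * n) := by
        field_simp; ring
      rw [e]
      apply div_nonneg _ (by positivity)
      linarith
    have t2 : ∑ j, (-(n * (10 / 21)) * ((Pi.single j 1 ⬝ᵥ x) ^ 2 +
        1 / 20 / n * (Pi.single j 1 ⬝ᵥ (Pi.single j 1 : Fin n → ℝ))) +
        n * 10 * ((Pi.single j 1 ⬝ᵥ x) ^ 2 +
        1 / 20 / n * (Pi.single j 1 ⬝ᵥ (Pi.single j 1 : Fin n → ℝ)) -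
        2 * x j * (Pi.single j 1 ⬝ᵥ x) + x j ^ 2)) = 0 := by
      have e : ∀ j, (-(n * (10 / 21)) * ((Pi.single j 1 ⬝ᵥ x) ^ 2 +
        1 / 20 / n * (Pi.single j 1 ⬝ᵥ (Pi.single j 1 : Fin n → ℝ))) +
        n * 10 * ((Pi.single j 1 ⬝ᵥ x) ^ 2 +
        1 / 20 / n * (Pi.single j 1 ⬝ᵥ (Pi.single j 1 : Fin n → ℝ)) -
        2 * x j * (Pi.single j 1 ⬝ᵥ x) + x j ^ 2)) =
          -(n * (10 / 21)) * (x j * x j) + 10 / 21 := by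
        intro j
        simp only [single_one_dotProduct, Pi.single_eq_same]
        field_simp; ring
      simp_rw [e]
      rw [Finset.sum_add_distrib, ← Finset.mul_sum]
      have : ∑ j, x j * x j = 1 := hx
      rw [this]; simp
    rw [t2, hx]
    have hnum := s17_numeric n hn1
    have hr' : (4 : ℝ) * n ≤ r := by exact_mod_cast hr
    have hlog : 0 ≤ Real.log 21 := Real.log_nonneg (by norm_num)
    have h1 : (n : ℝ) / 2 * Real.log 21 ≤ r * (Real.log 21 / 8) := by
      nlinarith
    have h2 : (r : ℝ) * (1 / 50) ≤ r * (c0 - 13 / 4 * (1 / 20 / n) - Real.log 21 / 8) := by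
      apply mul_le_mul_of_nonneg_left _ (Nat.cast_nonneg r)
      rw [hc0]; exact hnum
    have h3 : (r : ℝ) * (c0 + (80 / 91 * (1 - 1) - 13 / 4 * (1 ^ 2 + 1 / 20 / n * 1 - 2 * 1 + 1)))
      = r * (c0 - 13 / 4 * (1 / 20 / n) - Real.log 21 / 8) + r * (Real.log 21 / 8) := by ring
    rw [h3]
    linarith
  · refine lintegral_mono fun y => ?_
    rw [← ENNReal.ofReal_prod_of_nonneg (fun i _ => (Real.exp_pos _).le),
      ← ENNReal.ofReal_mul (by positivity)]
    exact ENNReal.ofReal_le_ofReal (hgle y)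

/-- Random sampling guarantee: for `U` compact with compact polar, `V` the unit `ℓ₂`-ball,
and `w_1, …, w_r` i.i.d. standard Gaussian vectors with `u_i = w_i / γ_U(w_i)`, if
`r ≥ 4n`, then with probability at least `1 − e^{−r/50}`, for every `Y`,
`Θ°(Y)² ≥ max_i u_iᵀ Y Yᵀ u_i ≥ (1/κ²) Θ°(Y)²`. -/
theorem statement17 {n d : ℕ} (U : Set (Fin n → ℝ)) (hU : IsCompact U)
    (hUpolar : IsCompact (vpolar U)) (hU0 : (0 : Fin n → ℝ) ∈ convexHull ℝ U)
    (r : ℕ) (hr : 4 * n ≤ r) :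
    ENNReal.ofReal (1 - Real.exp (-(r : ℝ) / 50)) ≤
      Measure.pi (fun _ : Fin r => Measure.pi fun _ : Fin n => gaussianReal 0 1)
        {w : Fin r → Fin n → ℝ | ∀ Y : Matrix (Fin n) (Fin d) ℝ,
          (⨆ i : Fin r, ((gaugeR U (w i))⁻¹ • w i) ⬝ᵥ
              (Y * Yᵀ).mulVec ((gaugeR U (w i))⁻¹ • w i))
            ≤ (ThetaPolarL2 U Y) ^ 2 ∧
          (1 / (kappa17 (d := d) U) ^ 2) * (ThetaPolarL2 U Y) ^ 2 ≤
            ⨆ i : Fin r, ((gaugeR U (w i))⁻¹ • w i) ⬝ᵥ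
              (Y * Yᵀ).mulVec ((gaugeR U (w i))⁻¹ • w i)} := by
  have h0 := s17_U_nonempty hU0
  set P := Measure.pi (fun _ : Fin r => Measure.pi fun _ : Fin n => gaussianReal 0 1) with hP
  set B : Set (Fin r → Fin n → ℝ) :=
    {w | 0 < n ∧ ENNReal.ofReal (Real.exp (r / 50)) ≤ s17H (21 / 20 / n) w} with hB
  have hBm : MeasurableSet B := by
    rw [hB]
    by_cases hn : 0 < n
    · simp only [hn, true_and]
      exact measurableSet_le measurable_const (s17_meas_H _)
    · simp [hn]
  have hBP : P B ≤ ENNReal.ofReal (Real.exp (-(r : ℝ) / 50)) := by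
    by_cases hn : 0 < n
    · have hm := mul_meas_ge_le_lintegral (μ := P)
        (s17_meas_H (n := n) (r := r) (21 / 20 / n)) (ENNReal.ofReal (Real.exp (r / 50)))
      rw [hP, s17_mean_H hn, ← hP] at hm
      have hBe : B = {w | ENNReal.ofReal (Real.exp (r / 50)) ≤ s17H (21 / 20 / n) w} := by
        rw [hB]; simp [hn]
      rw [hBe]
      have e : Real.exp (-(r : ℝ) / 50) = (Real.exp (r / 50))⁻¹ := by
        rw [← Real.exp_neg]; congr 1; ring
      rw [e, ENNReal.ofReal_inv_of_pos (Real.exp_pos _), ENNReal.le_inv_iff_mul_le, mul_comm]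
      exact hm
    · have : B = ∅ := by rw [hB]; simp [hn]
      rw [this]; simp
  have hsub : Bᶜ ⊆ {w : Fin r → Fin n → ℝ | ∀ Y : Matrix (Fin n) (Fin d) ℝ,
          (⨆ i : Fin r, ((gaugeR U (w i))⁻¹ • w i) ⬝ᵥ
              (Y * Yᵀ).mulVec ((gaugeR U (w i))⁻¹ • w i))
            ≤ (ThetaPolarL2 U Y) ^ 2 ∧
          (1 / (kappa17 (d := d) U) ^ 2) * (ThetaPolarL2 U Y) ^ 2 ≤
            ⨆ i : Fin r, ((gaugeR U (w i))⁻¹ • w i) ⬝ᵥ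
              (Y * Yᵀ).mulVec ((gaugeR U (w i))⁻¹ • w i)} := by
    intro w hw Y
    refine ⟨Real.iSup_le (fun i => s17_upper hU h0 Y (w i)) (sq_nonneg _), ?_⟩
    refine s17_lower hU hUpolar h0 w ?_ Y
    intro x hx
    by_contra! hcon
    apply hw
    have hn : 0 < n := by
      rcases Nat.eq_zero_or_pos n with h | h
      · subst h; exact absurd (Subsingleton.elim x 0) hx
      · exact h
    refine ⟨hn, ?_⟩
    have hpos := s17_dot_pos hx
    set q := Real.sqrt (x ⬝ᵥ x) with hq
    have hq0 : 0 < q := Real.sqrt_pos.2 hpos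
    have hqq : q ^ 2 = x ⬝ᵥ x := Real.sq_sqrt hpos.le
    refine s17_H_large hn hr w (q⁻¹ • x) ?_ ?_
    · simp [← hqq]; field_simp
    · intro i
      have h1 := hcon i
      rw [← hqq] at h1
      simp only [smul_dotProduct, smul_eq_mul]
      have e : 16 * (n : ℝ) * (q⁻¹ * (x ⬝ᵥ w i)) ^ 2 = 16 * n * (x ⬝ᵥ w i) ^ 2 / q ^ 2 := by
        field_simp
      rw [e, div_le_iff₀ (by positivity)]
      exact h1
  refine le_trans ?_ (measure_mono hsub)
  rw [prob_compl_eq_one_sub hBm, ENNReal.ofReal_sub _ (Real.exp_pos _).le, ENNReal.ofReal_one]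
  exact tsub_le_tsub_left hBP 1

end
end
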